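/- arXiv:1804.09809 — 4 statements merged into one kernel-verified Lean document; each statement's English description precedes it below -/
import Mathlib

section
/- There is a computable instance of RT^{subt}_2 with no Σ⁰₂ solution: there exists a computable coloring c : ℕ → Bool such that for every computable relation R : ℕ → ℕ → ℕ → Bool, if the set H = {n | ∃ a, ∀ b, R n a b = true} is infinite, then there exist x, y, x', y' ∈ H with x ≠ y and x' ≠ y' such that c (subt x y) ≠ c (subt x' y'). -/
/-- The absolute difference function on ℕ. -/
def subt (x y : ℕ) : ℕ := max x y - min x y

/-- The two-coloring of `ℕ` obtained by rotating the circle `ℤ/N` by `a` and cutting it into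
two halves. -/
def rotColor (N a z : ℕ) : Bool := decide (2 * (a * z % N) < N)

/-- Every translate `w - F`, taken modulo `N`, receives both colors under `rotColor N a`. -/
def HitsBoth (N a : ℕ) (F : Finset ℕ) : Prop :=
  ∀ w < N, (∃ x ∈ F, rotColor N a (w + (N - 1) * x) = true) ∧
    ∃ x ∈ F, rotColor N a (w + (N - 1) * x) = false

section SecondMoment

variable {p : ℕ} [Fact p.Prime]

lemma card_affine_mem (x : ZMod p) (T : Finset (ZMod p)) :
    (Finset.univ.filter fun c : ZMod p × ZMod p => c.1 * x + c.2 ∈ T).card = p * T.card := by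
  have : (Finset.univ.filter fun c : ZMod p × ZMod p => c.1 * x + c.2 ∈ T).card
      = ((Finset.univ : Finset (ZMod p)) ×ˢ T).card := by
    refine Finset.card_nbij' (fun c => (c.1, c.1 * x + c.2)) (fun c => (c.1, c.2 - c.1 * x))
      ?_ ?_ ?_ ?_
    · intro c hc; simpa using hc
    · intro c hc; simpa using hc
    · intro c _; simp
    · intro c _; simp
  rw [this, Finset.card_product, Finset.card_univ, ZMod.card]

lemma card_affine_mem_pair {x y : ZMod p} (hxy : x ≠ y) (T : Finset (ZMod p)) :
    (Finset.univ.filter fun c : ZMod p × ZMod p =>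
      c.1 * x + c.2 ∈ T ∧ c.1 * y + c.2 ∈ T).card = T.card * T.card := by
  have h : x - y ≠ 0 := sub_ne_zero.2 hxy
  rw [← Finset.card_product]
  refine Finset.card_nbij' (fun c => (c.1 * x + c.2, c.1 * y + c.2))
    (fun c => ((c.1 - c.2) / (x - y), c.1 - (c.1 - c.2) / (x - y) * x)) ?_ ?_ ?_ ?_
  · intro c hc; simpa using hc
  · intro c hc
    have e : (c.1 - c.2) / (x - y) * y + (c.1 - (c.1 - c.2) / (x - y) * x) = c.2 := by
      field_simp; ring
    simpa [e] using hc
  · intro c _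
    ext
    · simp only; field_simp; ring
    · simp only; field_simp; ring
  · intro c _
    ext
    · simp
    · simp only; field_simp; ring

lemma card_affine_avoid_mul_le (F T : Finset (ZMod p)) :
    (Finset.univ.filter fun c : ZMod p × ZMod p => ∀ x ∈ F, c.1 * x + c.2 ∉ T).card
      * (F.card * T.card) ≤ p ^ 3 := by
  classical
  rcases Nat.eq_zero_or_pos (F.card * T.card) with h0 | hpos
  · simp [h0]
  let I : ZMod p → ZMod p × ZMod p → ℤ := fun x c => if c.1 * x + c.2 ∈ T then 1 else 0
  let X : ZMod p × ZMod p → ℤ := fun c => ∑ x ∈ F, I x c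
  have hone : ∀ x, ∑ c, I x c = p * T.card := by
    intro x
    simp only [I, Finset.sum_boole]
    exact_mod_cast card_affine_mem x T
  have htwo : ∀ x y, x ≠ y → ∑ c, I x c * I y c = T.card * T.card := by
    intro x y hxy
    simp only [I, ← ite_and, ite_mul, one_mul, zero_mul, Finset.sum_boole]
    exact_mod_cast card_affine_mem_pair hxy T
  have hdiag : ∀ x, ∑ c, I x c * I x c = p * T.card := by
    intro x
    rw [← hone x]
    refine Finset.sum_congr rfl fun c _ => ?_
    simp only [I]; split_ifs <;> simp
  have hX : ∑ c, X c = F.card * (p * T.card) := by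
    simp only [X]
    rw [Finset.sum_comm]
    simp [hone]
  have hXX : ∑ c, X c * X c
      = F.card * (p * T.card) + (F.card * F.card - F.card) * (T.card * T.card) := by
    have e : ∀ c, X c * X c = ∑ x ∈ F, ∑ y ∈ F, I x c * I y c := fun c => by
      simp only [X, Finset.sum_mul_sum]
    simp only [e]
    rw [Finset.sum_comm]
    have e2 : ∀ x ∈ F, ∑ c, ∑ y ∈ F, I x c * I y c
        = p * T.card + (F.card - 1) * (T.card * T.card : ℤ) := by
      intro x hx
      rw [Finset.sum_comm, ← Finset.add_sum_erase _ _ hx, hdiag,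
        Finset.sum_congr rfl fun y hy => htwo x y (Finset.ne_of_mem_erase hy).symm,
        Finset.sum_const, Finset.card_erase_of_mem hx, nsmul_eq_mul,
        Nat.cast_sub (Finset.card_pos.2 ⟨x, hx⟩)]
      simp
    rw [Finset.sum_congr rfl e2, Finset.sum_const, nsmul_eq_mul]
    ring
  set B := Finset.univ.filter fun c : ZMod p × ZMod p => ∀ x ∈ F, c.1 * x + c.2 ∉ T with hB
  have hcard : ((Finset.univ : Finset (ZMod p × ZMod p)).card : ℤ) = p * p := by
    simp [ZMod.card]
  have hvar : ∑ c, (p * X c - F.card * T.card) ^ 2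
      = (p : ℤ) ^ 2 * (F.card * T.card) * (p - T.card) := by
    have e : ∀ c, (p * X c - F.card * T.card : ℤ) ^ 2
        = p ^ 2 * (X c * X c) - 2 * p * (F.card * T.card) * X c + (F.card * T.card) ^ 2 :=
      fun c => by ring
    simp only [e]
    rw [Finset.sum_add_distrib, Finset.sum_sub_distrib, ← Finset.mul_sum, ← Finset.mul_sum, hX,
      hXX, Finset.sum_const, nsmul_eq_mul, hcard]
    ring
  have hle : (B.card : ℤ) * (F.card * T.card) ^ 2 ≤ ∑ c, (p * X c - F.card * T.card : ℤ) ^ 2 := by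
    rw [← nsmul_eq_mul, ← Finset.sum_const]
    refine (Finset.sum_le_sum fun c hc => ?_).trans
      (Finset.sum_le_univ_sum_of_nonneg (s := B) fun c => sq_nonneg _)
    have : X c = 0 := Finset.sum_eq_zero fun x hx => by
      simp only [I]
      exact if_neg ((Finset.mem_filter.1 hc).2 x hx)
    rw [this]
    apply le_of_eq; ring
  rw [hvar] at hle
  have hpos' : (0 : ℤ) < F.card * T.card := by exact_mod_cast hpos
  have : (B.card : ℤ) * (F.card * T.card) ≤ p ^ 3 := by
    refine le_of_mul_le_mul_right ?_ hpos'
    have : (0 : ℤ) ≤ p ^ 2 * (F.card * T.card) * T.card := by positivity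
    nlinarith
  exact_mod_cast this

end SecondMoment

/-- The `i`-th of eight consecutive arcs of length `p / 8` in `ZMod p`. -/
def arc (p i : ℕ) : Finset (ZMod p) :=
  (Finset.Ico (i * (p / 8)) ((i + 1) * (p / 8))).image fun m : ℕ => (m : ZMod p)

lemma card_arc {p i : ℕ} (hi : i < 8) : (arc p i).card = p / 8 := by
  have hp : 8 * (p / 8) ≤ p := Nat.mul_div_le p 8
  rw [arc, Finset.card_image_of_injOn, Nat.card_Ico, add_mul, one_mul, Nat.add_sub_cancel_left]
  intro m hm m' hm' h
  have key : (i + 1) * (p / 8) ≤ p := (Nat.mul_le_mul_right _ hi).trans hp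
  have hm := (Finset.mem_Ico.1 hm).2.trans_le key
  have hm' := (Finset.mem_Ico.1 hm').2.trans_le key
  simpa [ZMod.natCast_eq_natCast_iff', Nat.mod_eq_of_lt hm, Nat.mod_eq_of_lt hm'] using h

lemma val_mem_of_mem_arc {p i : ℕ} (hi : i < 8) {v : ZMod p} (hv : v ∈ arc p i) :
    i * (p / 8) ≤ v.val ∧ v.val < (i + 1) * (p / 8) := by
  obtain ⟨m, hm, rfl⟩ := Finset.mem_image.1 hv
  have hp : 8 * (p / 8) ≤ p := Nat.mul_div_le p 8
  have key : (i + 1) * (p / 8) ≤ p := (Nat.mul_le_mul_right _ hi).trans hp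
  have hm := Finset.mem_Ico.1 hm
  rwa [ZMod.val_natCast, Nat.mod_eq_of_lt (hm.2.trans_le key)]

/-- A set meeting all eight arcs has a point shortly before any given point of the circle. -/
lemma exists_val_sub_le {p : ℕ} [NeZero p] {S : Finset (ZMod p)} (hp : 72 ≤ p)
    (hS : ∀ i < 8, ∃ v ∈ S, v ∈ arc p i) (u : ZMod p) :
    ∃ v ∈ S, (u - v).val ≤ 2 * (p / 8) + 7 := by
  have hu : u.val < p := ZMod.val_lt u
  set q := p / 8 with hq
  have hval : ∀ v : ZMod p, (v.val ≤ u.val → (u - v).val = u.val - v.val) ∧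
      (u.val < v.val → (u - v).val = u.val + p - v.val) := by
    intro v
    have hv : v.val < p := ZMod.val_lt v
    refine ⟨fun h => ZMod.val_sub h, fun h => ?_⟩
    have e : u - v = ((u.val + p - v.val : ℕ) : ZMod p) := by
      rw [Nat.cast_sub (by omega)]; simp
    rw [e, ZMod.val_natCast, Nat.mod_eq_of_lt (by omega)]
  rcases lt_or_ge u.val q with h | h
  · obtain ⟨v, hvS, hv⟩ := hS 7 (by norm_num)
    obtain ⟨h1, h2⟩ := val_mem_of_mem_arc (by norm_num) hv
    refine ⟨v, hvS, ?_⟩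
    rw [(hval v).2 (by omega)]
    omega
  · have hq0 : 0 < q := by omega
    obtain ⟨i, hi⟩ : ∃ i, u.val / q = i + 1 :=
      ⟨u.val / q - 1, by have := (Nat.one_le_div_iff hq0).2 h; omega⟩
    have hdm := Nat.div_add_mod u.val q
    have hml := Nat.mod_lt u.val hq0
    rw [hi] at hdm
    have hi8 : i < 8 := by
      by_contra hcon
      have : q * 9 ≤ q * (i + 1) := Nat.mul_le_mul_left _ (by omega)
      omega
    obtain ⟨v, hvS, hv⟩ := hS i hi8
    obtain ⟨h1, h2⟩ := val_mem_of_mem_arc hi8 hv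
    rw [← hq] at h1 h2
    refine ⟨v, hvS, ?_⟩
    have e1 : (i + 1) * q = q * (i + 1) := mul_comm _ _
    have e2 : (i + 1) * q = i * q + q := by ring
    rw [(hval v).1 (by omega)]
    omega

lemma hitsBoth_of_forall_arc {p : ℕ} [NeZero p] (hp : 72 ≤ p) (F : Finset ℕ) (a b : ZMod p)
    (h : ∀ i < 8, ∃ x ∈ F, a * (x : ZMod p) + b ∈ arc p i) : HitsBoth p a.val F := by
  classical
  have key : ∀ u : ZMod p, ∃ x ∈ F, (u - (a * (x : ZMod p) + b)).val ≤ 2 * (p / 8) + 7 := by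
    intro u
    obtain ⟨v, hv, hle⟩ := exists_val_sub_le
      (S := F.image fun x : ℕ => a * (x : ZMod p) + b) hp
      (fun i hi => by
        obtain ⟨x, hx, hxi⟩ := h i hi
        exact ⟨_, Finset.mem_image_of_mem _ hx, hxi⟩) u
    obtain ⟨x, hx, rfl⟩ := Finset.mem_image.1 hv
    exact ⟨x, hx, hle⟩
  have hmod : ∀ w x : ℕ, a.val * (w + (p - 1) * x) % p
      = ((a * w + b) - (a * (x : ZMod p) + b)).val := by
    intro w x
    rw [← ZMod.val_natCast]
    congr 1
    push_cast [Nat.cast_sub (show 1 ≤ p by omega)]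
    simp
    ring
  intro w _
  constructor
  · obtain ⟨x, hx, hle⟩ := key (a * w + b)
    refine ⟨x, hx, ?_⟩
    rw [rotColor, hmod, decide_eq_true_iff]
    omega
  · obtain ⟨x, hx, hle⟩ := key (a * w + b - (((p + 1) / 2 : ℕ) : ZMod p))
    refine ⟨x, hx, ?_⟩
    rw [rotColor, hmod, decide_eq_false_iff_not]
    set v := a * (x : ZMod p) + b
    have e : a * w + b - v = (a * w + b - (((p + 1) / 2 : ℕ) : ZMod p) - v)
        + (((p + 1) / 2 : ℕ) : ZMod p) := by ring
    have hh : (((p + 1) / 2 : ℕ) : ZMod p).val = (p + 1) / 2 := by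
      rw [ZMod.val_natCast, Nat.mod_eq_of_lt (by omega)]
    rw [e, ZMod.val_add_of_lt (by rw [hh]; omega), hh]
    omega

/-- A finite family of large finite sets admits a common rotation hitting both colors on every
translate of every member. -/
theorem exists_hitsBoth {ι : Type*} (I : Finset ι) (F : ι → Finset ℕ)
    (hne : ∀ i ∈ I, (F i).Nonempty) (hsum : ∑ i ∈ I, (72 : ℚ) / (F i).card < 1) :
    ∃ N a, 0 < N ∧ ∀ i ∈ I, HitsBoth N a (F i) := by
  classical
  obtain ⟨p, hpge, hprime⟩ := Nat.exists_infinite_primes (72 + (I.biUnion F).sup id + 1)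
  have : Fact p.Prime := ⟨hprime⟩
  have hp72 : 72 ≤ p := by omega
  have hcast : ∀ i ∈ I, ((F i).image fun x : ℕ => (x : ZMod p)).card = (F i).card := by
    intro i hi
    refine Finset.card_image_of_injOn fun x hx y hy hxy => ?_
    have hlt : ∀ z ∈ F i, z < p := fun z hz => by
      have : id z ≤ (I.biUnion F).sup id :=
        Finset.le_sup (f := id) (Finset.mem_biUnion.2 ⟨i, hi, hz⟩)
      simp only [id] at this
      omega
    simpa [ZMod.natCast_eq_natCast_iff', Nat.mod_eq_of_lt (hlt x hx),
      Nat.mod_eq_of_lt (hlt y hy)] using hxy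
  let bad : ι → ℕ → Finset (ZMod p × ZMod p) := fun i j => Finset.univ.filter fun c =>
    ∀ x ∈ (F i).image fun x : ℕ => (x : ZMod p), c.1 * x + c.2 ∉ arc p j
  have hbad : ∀ i ∈ I, ∀ j < 8, ((bad i j).card : ℚ) ≤ 9 * p ^ 2 / (F i).card := by
    intro i hi j hj
    have h := card_affine_avoid_mul_le ((F i).image fun x : ℕ => (x : ZMod p)) (arc p j)
    rw [hcast i hi, card_arc hj] at h
    have hq : p ≤ 9 * (p / 8) := by omega
    have hF : 0 < (F i).card := Finset.card_pos.2 (hne i hi)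
    rw [le_div_iff₀ (by exact_mod_cast hF)]
    have : (bad i j).card * (F i).card * p ≤ 9 * p ^ 2 * p := by
      calc (bad i j).card * (F i).card * p
          ≤ (bad i j).card * (F i).card * (9 * (p / 8)) := Nat.mul_le_mul_left _ hq
        _ = 9 * ((bad i j).card * ((F i).card * (p / 8))) := by ring
        _ ≤ 9 * p ^ 3 := Nat.mul_le_mul_left _ h
        _ = 9 * p ^ 2 * p := by ring
    exact_mod_cast Nat.le_of_mul_le_mul_right this hprime.pos
  have hlt : (I.biUnion fun i => (Finset.range 8).biUnion (bad i)).card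
      < (Finset.univ : Finset (ZMod p × ZMod p)).card := by
    have hp2 : (0 : ℚ) < p ^ 2 := by have := hprime.pos; positivity
    have : ((I.biUnion fun i => (Finset.range 8).biUnion (bad i)).card : ℚ) < p ^ 2 := by
      calc ((I.biUnion fun i => (Finset.range 8).biUnion (bad i)).card : ℚ)
          ≤ ∑ i ∈ I, ∑ j ∈ Finset.range 8, ((bad i j).card : ℚ) := by
            exact_mod_cast Finset.card_biUnion_le.trans
              (Finset.sum_le_sum fun i _ => Finset.card_biUnion_le)
        _ ≤ ∑ i ∈ I, ∑ j ∈ Finset.range 8, (9 * p ^ 2 / (F i).card : ℚ) :=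
            Finset.sum_le_sum fun i hi => Finset.sum_le_sum fun j hj =>
              hbad i hi j (Finset.mem_range.1 hj)
        _ = p ^ 2 * ∑ i ∈ I, (72 : ℚ) / (F i).card := by
            rw [Finset.mul_sum]
            refine Finset.sum_congr rfl fun i _ => ?_
            simp only [Finset.sum_const, Finset.card_range, nsmul_eq_mul]
            ring
        _ < p ^ 2 := by nlinarith
    have e : (Finset.univ : Finset (ZMod p × ZMod p)).card = p ^ 2 := by
      simp [ZMod.card, sq]
    rw [e]; exact_mod_cast this
  obtain ⟨c, -, hc⟩ := Finset.exists_mem_notMem_of_card_lt_card hlt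
  refine ⟨p, c.1.val, hprime.pos, fun i hi => hitsBoth_of_forall_arc hp72 (F i) c.1 c.2 ?_⟩
  intro j hj
  by_contra! hcon
  refine hc (Finset.mem_biUnion.2 ⟨i, hi, Finset.mem_biUnion.2 ⟨j, Finset.mem_range.2 hj, ?_⟩⟩)
  refine Finset.mem_filter.2 ⟨Finset.mem_univ _, fun x hx => ?_⟩
  obtain ⟨m, hm, rfl⟩ := Finset.mem_image.1 hx
  exact hcon m hm

section Primrec

open Primrec

variable {α : Type*} [Primcodable α]

lemma primrecPred_forall_lt {P : α → ℕ → Prop} {g : α → ℕ}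
    (hP : PrimrecPred fun q : α × ℕ => P q.1 q.2) (hg : Primrec g) :
    PrimrecPred fun q => ∀ x < g q, P q x := by
  have h : PrimrecRel fun (x : ℕ) (q : α) => P q x := hP.comp (snd.pair fst)
  exact (PrimrecRel.forall_mem_list h |>.comp (list_range.comp hg) Primrec.id).of_eq (by simp)

lemma primrecPred_exists_lt {P : α → ℕ → Prop} {g : α → ℕ}
    (hP : PrimrecPred fun q : α × ℕ => P q.1 q.2) (hg : Primrec g) :
    PrimrecPred fun q => ∃ x < g q, P q x := by
  have h : PrimrecRel fun (x : ℕ) (q : α) => P q x := hP.comp (snd.pair fst)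
  exact (PrimrecRel.exists_mem_list h |>.comp (list_range.comp hg) Primrec.id).of_eq (by simp)

open Classical in
lemma primrec_card_filter_range {P : α → ℕ → Prop} {g : α → ℕ}
    (hP : PrimrecPred fun q : α × ℕ => P q.1 q.2) (hg : Primrec g) :
    Primrec fun q => ((Finset.range (g q)).filter (P q)).card := by
  have h : PrimrecRel fun (x : ℕ) (q : α) => P q x := hP.comp (snd.pair fst)
  refine (list_length.comp (h.listFilter.comp (list_range.comp hg) Primrec.id)).of_eq fun q => ?_
  rfl

lemma PrimrecPred.imp {P Q : α → Prop} (hP : PrimrecPred P) (hQ : PrimrecPred Q) :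
    PrimrecPred fun q => P q → Q q :=
  (hP.not.or hQ).of_eq fun q => by tauto

lemma exists_computable_choice {P : ℕ → ℕ → Prop} (hP : PrimrecRel P) (h : ∀ n, ∃ m, P n m) :
    ∃ f : ℕ → ℕ, Computable f ∧ ∀ n, P n (f n) := by
  obtain ⟨inst, hp⟩ := hP
  let D : ℕ → ℕ → Bool := fun n m => @decide _ (inst (n, m))
  have hD : Computable₂ D := hp.to_comp
  have hdom : ∀ n, (Nat.rfind (D n : ℕ →. Bool)).Dom := fun n => by
    obtain ⟨m, hm⟩ := h n
    obtain ⟨k, hk, -⟩ := Nat.rfind_min' (p := D n) (m := m) (by simpa [D] using hm)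
    exact Part.dom_iff_mem.2 ⟨k, hk⟩
  refine ⟨fun n => (Nat.rfind (D n : ℕ →. Bool)).get (hdom n), ?_, fun n => ?_⟩
  · have hr : Partrec fun n => Nat.rfind (D n : ℕ →. Bool) := Partrec.rfind hD.partrec₂
    exact hr.of_eq fun n => Part.eq_some_iff.2 (Part.get_mem _)
  · have := Nat.rfind_spec (Part.get_mem (hdom n))
    simpa [D] using this

end Primrec

/-- No counterexample to `∀ b, R x a b` is found in `n` steps, for `R` computed by the `e`-th
code. -/
def Unrefuted (e n x a : ℕ) : Prop :=
  ∀ b < n, Nat.Partrec.Code.evaln n (Denumerable.ofNat Nat.Partrec.Code e)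
    (Nat.pair x (Nat.pair a b)) ≠ some 0

open Classical in
/-- The stage `n` approximation to the part of the `e`-th `Σ⁰₂` set lying in `[l, h)` with
witnesses below `B`. -/
noncomputable def stageSet (e n B l h : ℕ) : Finset ℕ :=
  (Finset.range h).filter fun x => l ≤ x ∧ ∃ a < B, Unrefuted e n x a

lemma mem_stageSet {e n B l h x : ℕ} :
    x ∈ stageSet e n B l h ↔ x < h ∧ l ≤ x ∧ ∃ a < B, Unrefuted e n x a := by
  simp [stageSet]

/-- The number of elements demanded from the `e`-th set. -/
def demand (e : ℕ) : ℕ := 2 ^ (e + 9)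

noncomputable def lowSet (e n t : ℕ) : Finset ℕ := stageSet e n t.unpair.2 0 t.unpair.1

noncomputable def highSet (e n t : ℕ) : Finset ℕ :=
  stageSet e n t.unpair.2 t.unpair.1 t.unpair.2

/-- At stage `n`, the pair coded by `t` provides two large pieces of the `e`-th set. -/
def Valid (e n t : ℕ) : Prop := demand e ≤ (lowSet e n t).card ∧ demand e ≤ (highSet e n t).card

def LeastValid (e n t : ℕ) : Prop := Valid e n t ∧ ∀ s < t, ¬ Valid e n s

/-- The rotation coded by `m` treats the stage `n` guesses for all `e < n` correctly. -/
def GoodRotation (n m : ℕ) : Prop :=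
  0 < m.unpair.1 ∧ ∀ e < n, ∀ t < n, LeastValid e n t →
    HitsBoth m.unpair.1 m.unpair.2 (lowSet e n t) ∧
    HitsBoth m.unpair.1 m.unpair.2 (highSet e n t)

section Computability

open Primrec

variable {α : Type*} [Primcodable α] {e n x a t B l h N z : α → ℕ}

lemma primrecPred_unrefuted (he : Primrec e) (hn : Primrec n) (hx : Primrec x) (ha : Primrec a) :
    PrimrecPred fun q => Unrefuted (e q) (n q) (x q) (a q) := by
  refine primrecPred_forall_lt (PrimrecPred.not (Primrec.eq.comp ?_ (const (some 0)))) hn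
  exact Nat.Partrec.Code.primrec_evaln.comp
    (((hn.comp fst).pair ((Primrec.ofNat _).comp (he.comp fst))).pair
      (Primrec₂.natPair.comp (hx.comp fst) (Primrec₂.natPair.comp (ha.comp fst) snd)))

lemma primrecPred_stageSet_aux (he : Primrec e) (hn : Primrec n) (hB : Primrec B) (hl : Primrec l)
    (hx : Primrec x) :
    PrimrecPred fun q => l q ≤ x q ∧ ∃ a < B q, Unrefuted (e q) (n q) (x q) a :=
  (nat_le.comp hl hx).and (primrecPred_exists_lt
    (primrecPred_unrefuted (he.comp fst) (hn.comp fst) (hx.comp fst) snd) hB)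

lemma primrec_card_stageSet (he : Primrec e) (hn : Primrec n) (hB : Primrec B) (hl : Primrec l)
    (hh : Primrec h) : Primrec fun q => (stageSet (e q) (n q) (B q) (l q) (h q)).card :=
  (primrec_card_filter_range (P := fun q x => l q ≤ x ∧ ∃ a < B q, Unrefuted (e q) (n q) x a)
    (primrecPred_stageSet_aux (he.comp fst) (hn.comp fst) (hB.comp fst) (hl.comp fst) snd) hh).of_eq
    fun _ => congrArg _ (by ext; simp [mem_stageSet])

lemma primrecPred_mem_stageSet (he : Primrec e) (hn : Primrec n) (hB : Primrec B) (hl : Primrec l)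
    (hh : Primrec h) (hx : Primrec x) :
    PrimrecPred fun q => x q ∈ stageSet (e q) (n q) (B q) (l q) (h q) :=
  ((nat_lt.comp hx hh).and (primrecPred_stageSet_aux he hn hB hl hx)).of_eq fun _ =>
    mem_stageSet.symm

lemma primrec_rotColor (hN : Primrec N) (ha : Primrec a) (hz : Primrec z) :
    Primrec fun q => rotColor (N q) (a q) (z q) :=
  (nat_lt.comp (nat_mul.comp (const 2) (nat_mod.comp (nat_mul.comp ha hz) hN)) hN).decide

lemma primrecPred_hitsBoth_stageSet (hN : Primrec N) (ha : Primrec a) (he : Primrec e)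
    (hn : Primrec n) (hB : Primrec B) (hl : Primrec l) (hh : Primrec h) :
    PrimrecPred fun q => HitsBoth (N q) (a q) (stageSet (e q) (n q) (B q) (l q) (h q)) := by
  have hcol : ∀ col : Bool, PrimrecPred fun q : α × ℕ =>
      ∃ x < h q.1, x ∈ stageSet (e q.1) (n q.1) (B q.1) (l q.1) (h q.1) ∧
        rotColor (N q.1) (a q.1) (q.2 + (N q.1 - 1) * x) = col := by
    intro col
    have f2 : Primrec fun r : (α × ℕ) × ℕ => r.1.1 := fst.comp fst
    refine primrecPred_exists_lt (PrimrecPred.and ?_ ?_) (hh.comp fst)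
    · exact primrecPred_mem_stageSet (he.comp f2) (hn.comp f2) (hB.comp f2) (hl.comp f2)
        (hh.comp f2) snd
    · exact Primrec.eq.comp (primrec_rotColor (hN.comp f2) (ha.comp f2)
        (nat_add.comp (snd.comp fst) (nat_mul.comp
          (nat_sub.comp (hN.comp f2) (const 1)) snd))) (const col)
  refine (primrecPred_forall_lt (P := fun q w => (∃ x < h q,
      x ∈ stageSet (e q) (n q) (B q) (l q) (h q) ∧
        rotColor (N q) (a q) (w + (N q - 1) * x) = true) ∧
      ∃ x < h q, x ∈ stageSet (e q) (n q) (B q) (l q) (h q) ∧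
        rotColor (N q) (a q) (w + (N q - 1) * x) = false)
    ((hcol true).and (hcol false)) hN).of_eq fun q => ?_
  have hlt : ∀ x ∈ stageSet (e q) (n q) (B q) (l q) (h q), x < h q := fun x hx =>
    (mem_stageSet.1 hx).1
  refine forall₂_congr fun w _ => and_congr ?_ ?_ <;>
  exact exists_congr fun x => ⟨fun h => h.2, fun h => ⟨hlt x h.1, h⟩⟩

lemma primrec_demand (he : Primrec e) : Primrec fun q => demand (e q) := by
  have hpow : Primrec fun k : ℕ => 2 ^ k :=
    (nat_rec₁ 1 (show Primrec₂ fun _ r : ℕ => 2 * r from nat_mul.comp (const 2) snd)).of_eq fun k => by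
      induction k with
      | zero => rfl
      | succ k ih => rw [pow_succ, ← ih, mul_comm]
  exact hpow.comp (nat_add.comp he (const 9))

lemma primrecPred_valid (he : Primrec e) (hn : Primrec n) (ht : Primrec t) :
    PrimrecPred fun q => Valid (e q) (n q) (t q) := by
  have h1 : Primrec fun q => (t q).unpair.1 := fst.comp (Primrec.unpair.comp ht)
  have h2 : Primrec fun q => (t q).unpair.2 := snd.comp (Primrec.unpair.comp ht)
  exact (nat_le.comp (primrec_demand he) (primrec_card_stageSet he hn h2 (const 0) h1)).and
    (nat_le.comp (primrec_demand he) (primrec_card_stageSet he hn h2 h1 h2))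

lemma primrecPred_leastValid (he : Primrec e) (hn : Primrec n) (ht : Primrec t) :
    PrimrecPred fun q => LeastValid (e q) (n q) (t q) :=
  (primrecPred_valid he hn ht).and (primrecPred_forall_lt
    (primrecPred_valid (he.comp fst) (hn.comp fst) snd).not ht)

lemma primrecRel_goodRotation : PrimrecRel GoodRotation := by
  have hm1 : Primrec fun q : ℕ × ℕ => q.2.unpair.1 := fst.comp (Primrec.unpair.comp snd)
  have hm2 : Primrec fun q : ℕ × ℕ => q.2.unpair.2 := snd.comp (Primrec.unpair.comp snd)
  refine (nat_lt.comp (const 0) hm1).and (primrecPred_forall_lt (primrecPred_forall_lt ?_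
    (fst.comp fst)) fst)
  have c : Primrec fun q : ((ℕ × ℕ) × ℕ) × ℕ => q.1.1 := fst.comp fst
  have hn : Primrec fun q : ((ℕ × ℕ) × ℕ) × ℕ => q.1.1.1 := fst.comp c
  have he : Primrec fun q : ((ℕ × ℕ) × ℕ) × ℕ => q.1.2 := snd.comp fst
  have ht : Primrec fun q : ((ℕ × ℕ) × ℕ) × ℕ => q.2 := snd
  have t1 := fst.comp (Primrec.unpair.comp ht)
  have t2 := snd.comp (Primrec.unpair.comp ht)
  exact (primrecPred_leastValid he hn ht).imp
    ((primrecPred_hitsBoth_stageSet (hm1.comp c) (hm2.comp c) he hn t2 (const 0) t1).and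
      (primrecPred_hitsBoth_stageSet (hm1.comp c) (hm2.comp c) he hn t2 t1 t2))

end Computability

lemma LeastValid.eq {e n s t : ℕ} (hs : LeastValid e n s) (ht : LeastValid e n t) : s = t := by
  rcases lt_trichotomy s t with h | h | h
  · exact absurd hs.1 (ht.2 s h)
  · exact h
  · exact absurd ht.1 (hs.2 t h)

lemma sum_demand_lt_one (n : ℕ) :
    ∑ q ∈ Finset.range n ×ˢ (Finset.univ : Finset Bool), (72 : ℚ) / demand q.1 < 1 := by
  have h : ∀ n : ℕ, ∑ e ∈ Finset.range n, (144 : ℚ) / demand e = 9 / 16 * (1 - 1 / 2 ^ n) := by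
    intro n
    induction n with
    | zero => simp
    | succ n ih =>
      rw [Finset.sum_range_succ, ih, demand]
      push_cast
      rw [pow_add, pow_succ]
      field_simp
      ring
  rw [Finset.sum_product]
  have e : ∀ k : ℕ, ∑ _b : Bool, (72 : ℚ) / demand k = 144 / demand k := fun k => by
    simp only [Fintype.sum_bool]; ring
  simp only [e, h]
  have : (0 : ℚ) < 1 / 2 ^ n := by positivity
  linarith

lemma exists_goodRotation (n : ℕ) : ∃ m, GoodRotation n m := by
  have hF : ∀ q : ℕ × Bool, ∃ F : Finset ℕ, demand q.1 ≤ F.card ∧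
      ∀ t, LeastValid q.1 n t → F = bif q.2 then lowSet q.1 n t else highSet q.1 n t := by
    rintro ⟨e, b⟩
    by_cases h : ∃ t, LeastValid e n t
    · obtain ⟨t, ht⟩ := h
      refine ⟨bif b then lowSet e n t else highSet e n t, ?_, fun s hs => by rw [hs.eq ht]⟩
      cases b
      · exact ht.1.2
      · exact ht.1.1
    · exact ⟨Finset.range (demand e), by simp, fun t ht => absurd ⟨t, ht⟩ h⟩
  choose F hcard hF using hF
  have hpos : ∀ e, 0 < demand e := fun e => by simp [demand]
  have hle : ∀ q : ℕ × Bool, (72 : ℚ) / (F q).card ≤ 72 / demand q.1 := fun q => by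
    have h1 : (0 : ℚ) < demand q.1 := Nat.cast_pos.2 (hpos q.1)
    have h2 : (demand q.1 : ℚ) ≤ (F q).card := Nat.cast_le.2 (hcard q)
    gcongr
  obtain ⟨N, a, hN, hit⟩ := exists_hitsBoth (Finset.range n ×ˢ (Finset.univ : Finset Bool)) F
    (fun q _ => Finset.card_pos.1 ((hpos q.1).trans_le (hcard q)))
    ((Finset.sum_le_sum fun q _ => hle q).trans_lt (sum_demand_lt_one n))
  have key : ∀ e < n, ∀ t, LeastValid e n t →
      HitsBoth N a (lowSet e n t) ∧ HitsBoth N a (highSet e n t) := by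
    intro e he t ht
    have hmem : ∀ b, (e, b) ∈ Finset.range n ×ˢ (Finset.univ : Finset Bool) := fun b =>
      Finset.mem_product.2 ⟨Finset.mem_range.2 he, Finset.mem_univ b⟩
    have h1 : F (e, true) = lowSet e n t := hF (e, true) t ht
    have h2 : F (e, false) = highSet e n t := hF (e, false) t ht
    exact ⟨h1 ▸ hit (e, true) (hmem true), h2 ▸ hit (e, false) (hmem false)⟩
  refine ⟨Nat.pair N a, ?_⟩
  rw [GoodRotation, Nat.unpair_pair]
  exact ⟨hN, fun e he t _ ht => key e he t ht⟩

lemma HitsBoth.exists_sub {N a : ℕ} {F : Finset ℕ} (h : HitsBoth N a F) (hN : 0 < N) {y : ℕ}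
    (hy : ∀ x ∈ F, x ≤ y) :
    (∃ x ∈ F, rotColor N a (y - x) = true) ∧ ∃ x ∈ F, rotColor N a (y - x) = false := by
  have key : ∀ x ∈ F, rotColor N a (y % N + (N - 1) * x) = rotColor N a (y - x) := by
    intro x hx
    have hm : y % N + (N - 1) * x ≡ y - x [MOD N] := by
      have h1 : y % N + (N - 1) * x ≡ y + (N - 1) * x [MOD N] := (Nat.mod_modEq y N).add_right _
      have h2 : y + (N - 1) * x = y - x + N * x := by
        obtain ⟨k, rfl⟩ : ∃ k, N = k + 1 := ⟨N - 1, by omega⟩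
        have := hy x hx
        rw [Nat.add_sub_cancel, add_mul, one_mul]
        omega
      rw [h2] at h1
      exact h1.trans (by simp [Nat.ModEq])
    have := hm.mul_left a
    simp only [rotColor]
    rw [this]
  obtain ⟨⟨x, hx, hxc⟩, x', hx', hxc'⟩ := h (y % N) (Nat.mod_lt _ hN)
  exact ⟨⟨x, hx, by rw [← key x hx, hxc]⟩, x', hx', by rw [← key x' hx', hxc']⟩

section Limit

variable {R : ℕ → ℕ → ℕ → Bool} {e : ℕ}

open Filter

/-- The code with index `e` computes the characteristic function of `R`. -/
def Computes (e : ℕ) (R : ℕ → ℕ → ℕ → Bool) : Prop :=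
  ∀ x a b, Nat.Partrec.Code.eval (Denumerable.ofNat Nat.Partrec.Code e)
    (Nat.pair x (Nat.pair a b)) = Part.some (Encodable.encode (R x a b))

lemma exists_computes (hR : Computable fun p : ℕ × ℕ × ℕ => R p.1 p.2.1 p.2.2) :
    ∃ e, Computes e R := by
  obtain ⟨c, hc⟩ := Nat.Partrec.Code.exists_code.1 hR
  refine ⟨Encodable.encode c, fun x a b => ?_⟩
  have := congrFun hc (Encodable.encode (x, a, b))
  rw [Denumerable.ofNat_encode]
  simpa using this

lemma eventually_unrefuted_iff (he : Computes e R) (x a : ℕ) :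
    ∀ᶠ n in atTop, (Unrefuted e n x a ↔ ∀ b, R x a b = true) := by
  by_cases h : ∀ b, R x a b = true
  · refine Eventually.of_forall fun n => iff_of_true (fun b _ hb => ?_) h
    have := Nat.Partrec.Code.evaln_sound hb
    rw [he, h b] at this
    simp at this
  · have h' := h
    push Not at h'
    obtain ⟨b, hb⟩ := h'
    have hb : R x a b = false := by simpa using hb
    have hmem : 0 ∈ Nat.Partrec.Code.eval (Denumerable.ofNat Nat.Partrec.Code e)
        (Nat.pair x (Nat.pair a b)) := by
      rw [he, hb]; simp
    obtain ⟨k, hk⟩ := Nat.Partrec.Code.evaln_complete.1 hmem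
    filter_upwards [eventually_gt_atTop b, eventually_ge_atTop k] with n hn hkn
    exact iff_of_false (fun hu => hu b hn (Nat.Partrec.Code.evaln_mono hkn hk)) h

open Classical in
/-- The eventual value of `stageSet`. -/
noncomputable def limitSet (R : ℕ → ℕ → ℕ → Bool) (B l h : ℕ) : Finset ℕ :=
  (Finset.range h).filter fun x => l ≤ x ∧ ∃ a < B, ∀ b, R x a b = true

lemma mem_limitSet {B l h x : ℕ} :
    x ∈ limitSet R B l h ↔ x < h ∧ l ≤ x ∧ ∃ a < B, ∀ b, R x a b = true := by
  simp [limitSet]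

lemma eventually_stageSet_eq (he : Computes e R) (B l h : ℕ) :
    ∀ᶠ n in atTop, stageSet e n B l h = limitSet R B l h := by
  have : ∀ᶠ n in atTop, ∀ x ∈ Finset.range h, ∀ a ∈ Finset.range B,
      (Unrefuted e n x a ↔ ∀ b, R x a b = true) :=
    (Filter.eventually_all_finset _).2 fun x _ => (Filter.eventually_all_finset _).2 fun a _ =>
      eventually_unrefuted_iff he x a
  filter_upwards [this] with n hn
  ext x
  rw [mem_stageSet, mem_limitSet]
  exact and_congr_right fun hx => and_congr_right fun _ => exists_congr fun a =>
    and_congr_right fun ha => hn x (Finset.mem_range.2 hx) a (Finset.mem_range.2 ha)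

lemma exists_limitSet_large (hinf : {n : ℕ | ∃ a, ∀ b, R n a b = true}.Infinite) (K : ℕ) :
    ∃ M B, K ≤ (limitSet R B 0 M).card ∧ K ≤ (limitSet R B M B).card := by
  obtain ⟨A, hA, hAc⟩ := hinf.exists_subset_card_eq K
  obtain ⟨M, hM⟩ : ∃ M, ∀ x ∈ A, x < M := ⟨A.sup id + 1, fun x hx =>
    Nat.lt_succ_of_le (Finset.le_sup (f := id) hx)⟩
  obtain ⟨A', hA', hAc'⟩ := (hinf.sdiff (Set.finite_lt_nat M)).exists_subset_card_eq K
  have hwit : ∀ x, ∃ a, x ∈ A ∪ A' → ∀ b, R x a b = true := by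
    intro x
    by_cases hx : x ∈ A ∪ A'
    · have : ∃ a, ∀ b, R x a b = true := by
        rcases Finset.mem_union.1 hx with h | h
        · exact hA h
        · exact (hA' h).1
      exact this.imp fun a ha _ => ha
    · exact ⟨0, fun h => absurd h hx⟩
  choose w hw using hwit
  refine ⟨M, (A ∪ A').sup (fun x => max x (w x)) + 1, ?_, ?_⟩ <;>
  set B := (A ∪ A').sup (fun x => max x (w x)) + 1 with hB
  all_goals
    have hlt : ∀ x ∈ A ∪ A', x < B ∧ w x < B := fun x hx => by
      have := Finset.le_sup (f := fun x => max x (w x)) hx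
      omega
  · rw [← hAc]
    refine Finset.card_le_card fun x hx => mem_limitSet.2 ⟨hM x hx,
      Nat.zero_le _, w x, ?_, ?_⟩
    · exact (hlt x (Finset.mem_union_left _ hx)).2
    · exact hw x (Finset.mem_union_left _ hx)
  · rw [← hAc']
    refine Finset.card_le_card fun x hx => mem_limitSet.2 ⟨?_, ?_,
      w x, ?_, ?_⟩
    · exact (hlt x (Finset.mem_union_right _ hx)).1
    · exact not_lt.1 (hA' hx).2
    · exact (hlt x (Finset.mem_union_right _ hx)).2
    · exact hw x (Finset.mem_union_right _ hx)

lemma exists_eventually_leastValid (he : Computes e R)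
    (hinf : {n : ℕ | ∃ a, ∀ b, R n a b = true}.Infinite) :
    ∃ t, ∀ᶠ n in atTop, LeastValid e n t ∧
      lowSet e n t = limitSet R t.unpair.2 0 t.unpair.1 ∧
      highSet e n t = limitSet R t.unpair.2 t.unpair.1 t.unpair.2 := by
  classical
  let V : ℕ → Prop := fun t => demand e ≤ (limitSet R t.unpair.2 0 t.unpair.1).card ∧
    demand e ≤ (limitSet R t.unpair.2 t.unpair.1 t.unpair.2).card
  have hV : ∃ t, V t := by
    obtain ⟨M, B, h1, h2⟩ := exists_limitSet_large hinf (demand e)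
    exact ⟨Nat.pair M B, by simpa [V] using And.intro h1 h2⟩
  have hlow : ∀ t, ∀ᶠ n in atTop, lowSet e n t = limitSet R t.unpair.2 0 t.unpair.1 :=
    fun t => eventually_stageSet_eq he _ _ _
  have hhigh : ∀ t, ∀ᶠ n in atTop,
      highSet e n t = limitSet R t.unpair.2 t.unpair.1 t.unpair.2 :=
    fun t => eventually_stageSet_eq he _ _ _
  have hvalid : ∀ t, ∀ᶠ n in atTop, (Valid e n t ↔ V t) := fun t => by
    filter_upwards [hlow t, hhigh t] with n h1 h2
    rw [Valid, h1, h2]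
  refine ⟨Nat.find hV, ?_⟩
  have hall : ∀ᶠ n in atTop, ∀ s ∈ Finset.range (Nat.find hV), (Valid e n s ↔ V s) :=
    (Filter.eventually_all_finset _).2 fun s _ => hvalid s
  filter_upwards [hlow (Nat.find hV), hhigh (Nat.find hV), hvalid (Nat.find hV), hall]
    with n h1 h2 h3 h4
  refine ⟨⟨h3.2 (Nat.find_spec hV), fun s hs hvs => ?_⟩, h1, h2⟩
  exact Nat.find_min hV hs ((h4 s (Finset.mem_range.2 hs)).1 hvs)

end Limit

/-- The coloring that uses the rotation coded by `f k` on the interval `[k ^ 2, (k + 1) ^ 2)`. -/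
def blockColor (f : ℕ → ℕ) (z : ℕ) : Bool :=
  rotColor (f z.sqrt).unpair.1 (f z.sqrt).unpair.2 z

lemma computable_blockColor {f : ℕ → ℕ} (hf : Computable f) : Computable (blockColor f) := by
  have h : Primrec fun q : ℕ × ℕ => rotColor q.1.unpair.1 q.1.unpair.2 q.2 :=
    primrec_rotColor (Primrec.fst.comp (Primrec.unpair.comp Primrec.fst))
      (Primrec.snd.comp (Primrec.unpair.comp Primrec.fst)) Primrec.snd
  have hp : Computable fun z : ℕ => (f z.sqrt, z) :=
    (hf.comp Primrec.nat_sqrt.to_comp).pair Computable.id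
  exact (h.to_comp.comp hp).of_eq fun z => by rw [blockColor]

lemma HitsBoth.exists_blockColor {f : ℕ → ℕ} {k y : ℕ} {F : Finset ℕ}
    (h : HitsBoth (f k).unpair.1 (f k).unpair.2 F) (hpos : 0 < (f k).unpair.1)
    (hy : ∀ x ∈ F, x ≤ y) (hk : ∀ x ∈ F, (y - x).sqrt = k) :
    ∃ x ∈ F, ∃ x' ∈ F, blockColor f (y - x) ≠ blockColor f (y - x') := by
  obtain ⟨⟨x, hx, hxc⟩, x', hx', hxc'⟩ := h.exists_sub hpos hy
  refine ⟨x, hx, x', hx', ?_⟩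
  rw [blockColor, blockColor, hk x hx, hk x' hx', hxc, hxc']
  decide

lemma subt_eq_sub {x y : ℕ} (h : x ≤ y) : subt x y = y - x := by
  rw [subt, max_eq_right h, min_eq_left h]

/-- There is a computable instance of `RT^{subt}_2` with no `Σ⁰₂` solution. -/
theorem stmt_5 :
    ∃ c : ℕ → Bool, Computable c ∧
      ∀ R : ℕ → ℕ → ℕ → Bool,
        Computable (fun p : ℕ × ℕ × ℕ => R p.1 p.2.1 p.2.2) →
        {n : ℕ | ∃ a : ℕ, ∀ b : ℕ, R n a b = true}.Infinite →
          ∃ x y x' y' : ℕ,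
            (∃ a, ∀ b, R x a b = true) ∧ (∃ a, ∀ b, R y a b = true) ∧
            (∃ a, ∀ b, R x' a b = true) ∧ (∃ a, ∀ b, R y' a b = true) ∧
            x ≠ y ∧ x' ≠ y' ∧ c (subt x y) ≠ c (subt x' y') := by
  obtain ⟨f, hf, hgood⟩ := exists_computable_choice primrecRel_goodRotation exists_goodRotation
  refine ⟨blockColor f, computable_blockColor hf, fun R hR hinf => ?_⟩
  obtain ⟨e, he⟩ := exists_computes hR
  obtain ⟨t, ht⟩ := exists_eventually_leastValid he hinf
  set M := t.unpair.1
  set B := t.unpair.2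
  obtain ⟨n₀, hn₀⟩ := Filter.eventually_atTop.1 ht
  obtain ⟨y, hyR, hylt⟩ := hinf.exists_gt ((n₀ + e + t + M + B + 2) ^ 2)
  set k := y.sqrt
  have hk : n₀ + e + t + M + B + 2 ≤ k := Nat.le_sqrt'.2 hylt.le
  have hky : k ^ 2 ≤ y := Nat.sqrt_le' y
  have hyk : y < (k + 1) ^ 2 := Nat.lt_succ_sqrt' y
  have hkk : k ≤ k ^ 2 := Nat.le_self_pow (by norm_num) k
  suffices ∃ j l h, h ≤ M + B ∧ HitsBoth (f j).unpair.1 (f j).unpair.2 (limitSet R B l h) ∧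
      0 < (f j).unpair.1 ∧ ∀ x, l ≤ x → x < h → (y - x).sqrt = j by
    obtain ⟨j, l, h, hh, hit, hpos, hj⟩ := this
    have hmem : ∀ x ∈ limitSet R B l h, x < h ∧ l ≤ x ∧ ∃ a, ∀ b, R x a b = true := by
      intro x hx
      obtain ⟨h1, h2, a, -, ha⟩ := mem_limitSet.1 hx
      exact ⟨h1, h2, a, ha⟩
    have hxy : ∀ x ∈ limitSet R B l h, x < y := fun x hx => by
      have := (hmem x hx).1
      omega
    obtain ⟨x, hx, x', hx', hne⟩ := hit.exists_blockColor hpos (fun x hx => (hxy x hx).le)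
      fun x hx => hj x (hmem x hx).2.1 (hmem x hx).1
    refine ⟨x, y, x', y, (hmem x hx).2.2, hyR, (hmem x' hx').2.2, hyR, (hxy x hx).ne,
      (hxy x' hx').ne, ?_⟩
    rwa [subt_eq_sub (hxy x hx).le, subt_eq_sub (hxy x' hx').le]
  have hits : ∀ j, n₀ + e + t + 1 ≤ j → 0 < (f j).unpair.1 ∧
      HitsBoth (f j).unpair.1 (f j).unpair.2 (limitSet R B 0 M) ∧
      HitsBoth (f j).unpair.1 (f j).unpair.2 (limitSet R B M B) := by
    intro j hj
    obtain ⟨hlv, hlow, hhigh⟩ := hn₀ j (by omega)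
    obtain ⟨hpos, hall⟩ := hgood j
    rw [← hlow, ← hhigh]
    exact ⟨hpos, hall e (by omega) t (by omega) hlv⟩
  rcases le_or_gt (k ^ 2) (y - M) with hcase | hcase
  · obtain ⟨hpos, hit, -⟩ := hits k (by omega)
    refine ⟨k, 0, M, by omega, hit, hpos, fun x _ hx => ?_⟩
    exact Nat.eq_sqrt'.2 ⟨by omega, by omega⟩ |>.symm
  · obtain ⟨hpos, -, hit⟩ := hits (k - 1) (by omega)
    refine ⟨k - 1, M, B, by omega, hit, hpos, fun x hx hxB => ?_⟩
    obtain ⟨i, hi⟩ : ∃ i, k = i + 1 := ⟨k - 1, by omega⟩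
    have e1 : k ^ 2 = i ^ 2 + 2 * i + 1 := by rw [hi]; ring
    rw [hi, Nat.add_sub_cancel]
    refine (Nat.eq_sqrt'.2 ⟨by omega, ?_⟩).symm
    rw [← hi]
    omega
end

section
/- There is a computable coloring c : ℕ → Bool such that no infinite computable subset of ℕ is a solution to c as an instance of RT^{subt}_2: for every set H ⊆ ℕ, if H is computable (as a predicate) and infinite, then there exist x, y, x', y' ∈ H with x ≠ y and x' ≠ y' such that c (subt x y) ≠ c (subt x' y'). In particular, RT^{subt}_2 is not computably true. -/
open Nat.Partrec in
/-- The largest value produced within `s` steps by one of the first `K` pairs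
(program, input), where `k` codes the program `k.unpair.1` on the input `k.unpair.2`. -/
def stageBound (s K : ℕ) : ℕ :=
  Nat.rec 0 (fun k b => max b
    ((Code.evaln s (Denumerable.ofNat Code k.unpair.1) k.unpair.2).getD 0)) K

/-- Stage `s` approximation to a divisibility chain of moduli, each of which dominates the
values computed by small programs from the previous one. -/
def modulus (s j : ℕ) : ℕ :=
  Nat.rec 1 (fun _ M => M * (stageBound s (Nat.pair M (Nat.pair M M)) + 2)) j

/-- The parity of the number of `j < n` for which the `(j + 1)`-st modulus at stage `n`
divides `n`. -/
def chainColoring (n : ℕ) : Bool :=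
  Nat.rec false (fun j b => bif decide (n % modulus n (j + 1) = 0) then !b else b) n

open Primrec in
theorem primrec_stageBound : Primrec₂ stageBound := by
  unfold stageBound
  refine Primrec.nat_rec' (f := fun p : ℕ × ℕ => p.2) (g := fun _ => 0)
    (h := fun p q => max q.2 ((Nat.Partrec.Code.evaln p.1
      (Denumerable.ofNat Nat.Partrec.Code q.1.unpair.1) q.1.unpair.2).getD 0))
    snd (const 0) ?_
  have hk : Primrec fun p : (ℕ × ℕ) × ℕ × ℕ => p.2.1.unpair :=
    Primrec.unpair.comp (fst.comp snd)
  refine nat_max.comp (snd.comp snd) (option_getD.comp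
    (Nat.Partrec.Code.primrec_evaln.comp
      (Primrec.pair (Primrec.pair (fst.comp fst) ?_) (snd.comp hk))) (const 0))
  exact (Primrec.ofNat Nat.Partrec.Code).comp (fst.comp hk)

open Primrec in
theorem primrec_modulus : Primrec₂ modulus := by
  unfold modulus
  refine Primrec.nat_rec' (f := fun p : ℕ × ℕ => p.2) (g := fun _ => 1)
    (h := fun p q => q.2 * (stageBound p.1 (Nat.pair q.2 (Nat.pair q.2 q.2)) + 2))
    snd (const 1) ?_
  have hM : Primrec fun p : (ℕ × ℕ) × ℕ × ℕ => p.2.2 := snd.comp snd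
  exact nat_mul.comp hM (nat_add.comp (primrec_stageBound.comp (fst.comp fst)
    (Primrec₂.natPair.comp hM (Primrec₂.natPair.comp hM hM))) (const 2))

open Primrec in
theorem primrec_chainColoring : Primrec chainColoring := by
  unfold chainColoring
  refine Primrec.nat_rec' (f := fun n : ℕ => n) (g := fun _ => false)
    (h := fun n q => bif decide (n % modulus n (q.1 + 1) = 0) then !q.2 else q.2)
    Primrec.id (const false) ?_
  have hdvd : PrimrecPred fun p : ℕ × ℕ × Bool => p.1 % modulus p.1 (p.2.1 + 1) = 0 :=
    Primrec.eq.comp (nat_mod.comp fst (primrec_modulus.comp fst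
      (succ.comp (fst.comp snd)))) (const 0)
  exact Primrec.cond hdvd.decide (Primrec.not.comp (snd.comp snd)) (snd.comp snd)

theorem modulus_zero (s : ℕ) : modulus s 0 = 1 := rfl

theorem modulus_succ (s j : ℕ) :
    modulus s (j + 1) = modulus s j *
      (stageBound s (Nat.pair (modulus s j) (Nat.pair (modulus s j) (modulus s j))) + 2) := rfl

theorem lt_modulus (s j : ℕ) : j < modulus s j := by
  induction j with
  | zero => simp [modulus_zero]
  | succ j ih => rw [modulus_succ]; nlinarith

theorem modulus_dvd (s : ℕ) {i j : ℕ} (h : i ≤ j) : modulus s i ∣ modulus s j := by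
  induction h with
  | refl => exact dvd_rfl
  | step _ ih => exact ih.trans (Dvd.intro _ rfl)

theorem stageBound_eventually_const (K : ℕ) :
    ∃ B S, ∀ s ≥ S, stageBound s K = B := by
  induction K with
  | zero => exact ⟨0, 0, fun _ _ => rfl⟩
  | succ K ih =>
    obtain ⟨B, S, hB⟩ := ih
    set c := Denumerable.ofNat Nat.Partrec.Code K.unpair.1 with hc
    have hstep (s : ℕ) : stageBound s (K + 1) =
        max (stageBound s K) ((c.evaln s K.unpair.2).getD 0) := rfl
    by_cases h : ∃ v s, v ∈ c.evaln s K.unpair.2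
    · obtain ⟨v, t, hv⟩ := h
      refine ⟨max B v, max S t, fun s hs => ?_⟩
      have := Nat.Partrec.Code.evaln_mono (le_of_max_le_right hs) hv
      rw [hstep, hB s (le_of_max_le_left hs), Option.mem_def.1 this, Option.getD_some]
    · push Not at h
      refine ⟨B, S, fun s hs => ?_⟩
      rw [hstep, hB s hs, Option.eq_none_iff_forall_not_mem.2 fun v => h v s]
      simp

theorem modulus_eventually_const (j : ℕ) : ∃ M S, ∀ s ≥ S, modulus s j = M := by
  induction j with
  | zero => exact ⟨1, 0, fun _ _ => rfl⟩
  | succ j ih =>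
    obtain ⟨M, S, hM⟩ := ih
    obtain ⟨B, T, hB⟩ := stageBound_eventually_const (Nat.pair M (Nat.pair M M))
    refine ⟨M * (B + 2), max S T, fun s hs => ?_⟩
    rw [modulus_succ, hM s (le_of_max_le_left hs), hB s (le_of_max_le_right hs)]

theorem le_stageBound {c : Nat.Partrec.Code} {s a v k K : ℕ} (hv : v ∈ c.evaln s a)
    (hk : k = Nat.pair (Encodable.encode c) a) (hK : k < K) : v ≤ stageBound s K := by
  induction K, hK using Nat.le_induction with
  | base =>
    refine le_max_of_le_right ?_
    subst hk
    simp [Option.mem_def.1 hv]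
  | succ K _ ih => exact le_max_of_le_left ih

theorem lt_modulus_succ {c : Nat.Partrec.Code} {s j r v : ℕ}
    (hv : v ∈ c.evaln s (Nat.pair (modulus s j) r))
    (hc : Encodable.encode c < modulus s j) (hr : r < modulus s j) :
    v < modulus s (j + 1) := by
  have hlt := (Nat.pair_lt_pair_left (Nat.pair (modulus s j) r) hc).trans
    (Nat.pair_lt_pair_right (modulus s j) (Nat.pair_lt_pair_right (modulus s j) hr))
  have := le_stageBound hv rfl hlt
  rw [modulus_succ]
  nlinarith [lt_modulus s j]

theorem chainColoring_eq {n j : ℕ} (hn : 0 < n) (hj : modulus n j ∣ n)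
    (hj' : ¬ modulus n (j + 1) ∣ n) : chainColoring n = Nat.bodd j := by
  have key (i : ℕ) : (Nat.rec false (fun j b =>
      bif decide (n % modulus n (j + 1) = 0) then !b else b) i : Bool) =
        Nat.bodd (min i j) := by
    induction i with
    | zero => simp
    | succ i ih =>
      simp only [ih]
      rcases lt_or_ge i j with h | h
      · have hd : n % modulus n (i + 1) = 0 :=
          Nat.mod_eq_zero_of_dvd ((modulus_dvd n h).trans hj)
        rw [min_eq_left h.le, min_eq_left (Nat.succ_le_of_lt h)]
        simp [hd]
      · have hd : ¬ n % modulus n (i + 1) = 0 := fun h0 =>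
          hj' ((modulus_dvd n (Nat.succ_le_succ h)).trans (Nat.dvd_of_mod_eq_zero h0))
        rw [min_eq_right h, min_eq_right (h.trans i.le_succ)]
        simp [hd]
  have := key n
  rwa [min_eq_right ((lt_modulus n j).le.trans (Nat.le_of_dvd hn hj))] at this

/-- For a computable set `H` there is a program which, given `m` and `r`, finds a pair of
distinct elements of `H` that are congruent to `r` modulo `m`, if there is one. -/
theorem exists_code_congruent_pair {H : Set ℕ} (hH : ComputablePred (· ∈ H)) :
    ∃ c : Nat.Partrec.Code, ∀ m r x y : ℕ, x ∈ H → y ∈ H → x < y → x % m = r → y % m = r →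
      ∃ v ∈ c.eval (Nat.pair m r), ∃ x ∈ H, ∃ y ∈ H, x < y ∧ y ≤ v ∧ x % m = r ∧ y % m = r := by
  obtain ⟨f, hf, hfH⟩ := ComputablePred.computable_iff.1 hH
  replace hfH (x : ℕ) : x ∈ H ↔ f x = true := iff_of_eq (congrFun hfH x)
  let P (a k : ℕ) : Bool := f k.unpair.1 && (f k.unpair.2 &&
    decide (k.unpair.1 < k.unpair.2 ∧ k.unpair.1 % a.unpair.1 = a.unpair.2 ∧
      k.unpair.2 % a.unpair.1 = a.unpair.2))
  have hP : Computable₂ P := by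
    have ha : Primrec fun p : ℕ × ℕ => p.1.unpair := Primrec.unpair.comp Primrec.fst
    have hk : Primrec fun p : ℕ × ℕ => p.2.unpair := Primrec.unpair.comp Primrec.snd
    have hk₁ := Primrec.fst.comp hk
    have hk₂ := Primrec.snd.comp hk
    have ha₁ := Primrec.fst.comp ha
    have ha₂ := Primrec.snd.comp ha
    have hd := ((Primrec.nat_lt.comp hk₁ hk₂).and
      ((Primrec.eq.comp (Primrec.nat_mod.comp hk₁ ha₁) ha₂).and
        (Primrec.eq.comp (Primrec.nat_mod.comp hk₂ ha₁) ha₂))).decide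
    exact Primrec.and.to_comp.comp (hf.comp hk₁.to_comp)
      (Primrec.and.to_comp.comp (hf.comp hk₂.to_comp) hd.to_comp)
  obtain ⟨c, hc⟩ := Nat.Partrec.Code.exists_code.1
    (Partrec.nat_iff.1 (Partrec.rfind hP.partrec₂))
  refine ⟨c, fun m r x y hx hy hxy hxr hyr => ?_⟩
  have hxyP : P (Nat.pair m r) (Nat.pair x y) = true := by
    simp [P, ← hfH, hx, hy, hxy, hxr, hyr]
  obtain ⟨v, hv, -⟩ := Nat.rfind_min' hxyP
  have hPv : P (Nat.pair m r) v = true :=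
    (Part.mem_some_iff.1 (Nat.rfind_spec hv)).symm
  simp only [P, Bool.and_eq_true, ← hfH, decide_eq_true_eq, Nat.unpair_pair] at hPv
  obtain ⟨h₁, h₂, h₃, h₄, h₅⟩ := hPv
  refine ⟨v, ?_, _, h₁, _, h₂, h₃, Nat.unpair_right_le v, h₄, h₅⟩
  rw [hc]
  exact hv

theorem exists_infinite_residue {H : Set ℕ} (hH : H.Infinite) {m : ℕ} (hm : 0 < m) :
    ∃ r < m, {z ∈ H | z % m = r}.Infinite := by
  by_contra! h
  refine hH (((Set.finite_lt_nat m).biUnion (t := fun r => {z ∈ H | z % m = r})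
    fun r hr => h r hr).subset fun z hz => ?_)
  exact Set.mem_biUnion (Nat.mod_lt z hm) ⟨hz, rfl⟩

theorem exists_chainColoring_subt_eq {H : Set ℕ} (hH : ComputablePred (· ∈ H))
    (hinf : H.Infinite) (b : Bool) :
    ∃ x ∈ H, ∃ y ∈ H, x ≠ y ∧ chainColoring (subt x y) = b := by
  obtain ⟨c, hc⟩ := exists_code_congruent_pair hH
  obtain ⟨j, hcj, hjb⟩ : ∃ j, Encodable.encode c ≤ j ∧ Nat.bodd j = b :=
    ⟨2 * Encodable.encode c + b.toNat, by omega, by cases b <;> simp⟩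
  obtain ⟨M, S, hM⟩ := modulus_eventually_const j
  obtain ⟨M', S', hM'⟩ := modulus_eventually_const (j + 1)
  have hjM : j < M := hM S le_rfl ▸ lt_modulus S j
  obtain ⟨r, hr, hrinf⟩ := exists_infinite_residue hinf (Nat.zero_lt_of_lt hjM)
  obtain ⟨x₀, hx₀⟩ := hrinf.nonempty
  obtain ⟨y₀, hy₀, hxy₀⟩ := hrinf.exists_gt x₀
  obtain ⟨v, hv, x, hx, y, hy, hxy, hyv, hxr, hyr⟩ :=
    hc M r x₀ y₀ hx₀.1 hy₀.1 hxy₀ hx₀.2 hy₀.2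
  obtain ⟨t, ht⟩ := Nat.Partrec.Code.evaln_complete.1 hv
  have hvM' : v < M' := by
    let s := max t (max S S')
    have hsM : modulus s j = M := hM s (by omega)
    have hsM' : modulus s (j + 1) = M' := hM' s (by omega)
    rw [← hsM']
    refine lt_modulus_succ (c := c) (r := r) ?_ ?_ ?_ <;> rw [hsM]
    · exact Nat.Partrec.Code.evaln_mono (le_max_left _ _) ht
    · exact hcj.trans_lt hjM
    · exact hr
  obtain ⟨z, hz, hzlt⟩ := hrinf.exists_gt (y + S + S')
  have hcolor (w : ℕ) (hw : w ≤ y) (hwr : w % M = r) (hnd : ¬ M' ∣ z - w) :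
      z ≠ w ∧ chainColoring (subt z w) = b := by
    have hsub : subt z w = z - w := by simp only [subt]; omega
    refine ⟨by omega, ?_⟩
    rw [hsub, ← hjb]
    refine chainColoring_eq (by omega) ?_ ?_
    · rw [hM _ (by omega)]
      exact (Nat.modEq_iff_dvd' (by omega)).1 (hwr.trans hz.2.symm)
    · rwa [hM' _ (by omega)]
  by_cases hzx : M' ∣ z - x
  · refine ⟨z, hz.1, y, hy, hcolor y le_rfl hyr fun hzy => ?_⟩
    have hdvd : M' ∣ y - x := by
      have := Nat.dvd_sub hzx hzy
      rwa [show z - x - (z - y) = y - x by omega] at this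
    have := Nat.le_of_dvd (by omega) hdvd
    omega
  · exact ⟨z, hz.1, x, hx, hcolor x hxy.le hxr hzx⟩

/-- `RT^{subt}_2` is not computably true: there is a computable coloring `c` such that
no infinite computable set `H` is a solution of `c` as an instance of `RT^{subt}_2`. -/
theorem stmt_6 :
    ∃ c : ℕ → Bool, Computable c ∧
      ∀ H : Set ℕ, ComputablePred (· ∈ H) → H.Infinite →
        ∃ x ∈ H, ∃ y ∈ H, ∃ x' ∈ H, ∃ y' ∈ H,
          x ≠ y ∧ x' ≠ y' ∧ c (subt x y) ≠ c (subt x' y') := by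
  refine ⟨chainColoring, primrec_chainColoring.to_comp, fun H hH hinf => ?_⟩
  obtain ⟨x, hx, y, hy, hxy, hc⟩ := exists_chainColoring_subt_eq hH hinf true
  obtain ⟨x', hx', y', hy', hxy', hc'⟩ := exists_chainColoring_subt_eq hH hinf false
  exact ⟨x, hx, y, hy, x', hx', y', hy', hxy, hxy', by simp [hc, hc']⟩
end

section
/- Let f : ℕ → ℕ → ℕ be a symmetric addition-like function. Then there is a computable coloring c : ℕ → Bool such that every solution H to c as an instance of RT^f_2 is hyperimmune: for every computable sequence D : ℕ → Finset ℕ of pairwise disjoint nonempty finite sets, there is an i such that D i ∩ H = ∅. -/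
/-- `f` is addition-like: it is computable; there is a computable `g` such that
`f x y > n` whenever `y > g x n`; and there is a bound `b` such that for all `x ≠ y`
there are at most `b` many `z ≠ x` with `f x z = f x y`. -/
def AdditionLike (f : ℕ → ℕ → ℕ) : Prop :=
  Computable₂ f ∧
  (∃ g : ℕ → ℕ → ℕ, Computable₂ g ∧ ∀ x n y, y > g x n → f x y > n) ∧
  (∃ b : ℕ, ∀ x y, x ≠ y →
    ∀ S : Finset ℕ, (∀ z ∈ S, z ≠ x ∧ f x z = f x y) → S.card ≤ b)

/-- The subsets `A` of `S` such that, seen as a 2-coloring of `S`, no edge `E i` with `i ∈ I`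
contained in `S` is monochromatic. -/
def properSubsets {ι α : Type*} [DecidableEq α] (I : Finset ι) (E : ι → Finset α)
    (S : Finset α) : Finset (Finset α) :=
  S.powerset.filter fun A => ∀ i ∈ I, E i ⊆ S → ¬ E i ⊆ A ∧ ¬ Disjoint (E i) A

section Counting

variable {ι α : Type*} [DecidableEq α] {I : Finset ι} {E : ι → Finset α}

theorem mem_properSubsets {S A : Finset α} : A ∈ properSubsets I E S ↔
    A ⊆ S ∧ ∀ i ∈ I, E i ⊆ S → ¬ E i ⊆ A ∧ ¬ Disjoint (E i) A := by
  simp [properSubsets]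

theorem two_mul_card_properSubsets_le {S : Finset α} {v : α} (hv : v ∉ S) :
    2 * (properSubsets I E S).card ≤ (properSubsets I E (insert v S)).card +
      ∑ i ∈ I with v ∈ E i ∧ E i ⊆ insert v S, 2 * (properSubsets I E (S \ E i)).card := by
  classical
  set P := properSubsets I E S with hP
  have hvA : ∀ A ∈ P, v ∉ A := fun A hA h => hv ((mem_properSubsets.1 hA).1 h)
  have hcard : (P ∪ P.image (insert v)).card = 2 * P.card := by
    rw [Finset.card_union_of_disjoint, Finset.card_image_of_injOn]
    · ring
    · intro A hA B hB h
      have := congrArg (fun C : Finset α => C.erase v) h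
      simpa [Finset.erase_insert (hvA A hA), Finset.erase_insert (hvA B hB)] using this
    · rw [Finset.disjoint_left]
      intro A hA hA'
      obtain ⟨B, -, rfl⟩ := Finset.mem_image.1 hA'
      exact hvA _ hA (Finset.mem_insert_self _ _)
  rw [← hcard]
  have hsub : P ∪ P.image (insert v) ⊆ properSubsets I E (insert v S) ∪
      (I.filter fun i => v ∈ E i ∧ E i ⊆ insert v S).biUnion fun i =>
        properSubsets I E (S \ E i) ∪ (properSubsets I E (S \ E i)).image (· ∪ E i) := by
    intro A hA
    have hA' : A ⊆ insert v S ∧ A.erase v ∈ P := by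
      rcases Finset.mem_union.1 hA with h | h
      · exact ⟨(mem_properSubsets.1 h).1.trans (Finset.subset_insert _ _),
          by rwa [Finset.erase_eq_of_notMem (hvA A h)]⟩
      · obtain ⟨B, hB, rfl⟩ := Finset.mem_image.1 h
        exact ⟨Finset.insert_subset_insert _ (mem_properSubsets.1 hB).1,
          by rwa [Finset.erase_insert (hvA B hB)]⟩
    obtain ⟨hAS, hAP⟩ := hA'
    by_cases hgood : A ∈ properSubsets I E (insert v S)
    · exact Finset.mem_union_left _ hgood
    refine Finset.mem_union_right _ ?_
    have hbad : ∃ i ∈ I, E i ⊆ insert v S ∧ (E i ⊆ A ∨ Disjoint (E i) A) := by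
      by_contra hcon
      push Not at hcon
      exact hgood (mem_properSubsets.2 ⟨hAS, fun i hi hiS => hcon i hi hiS⟩)
    obtain ⟨i, hi, hiS, hiA⟩ := hbad
    have hnot := (mem_properSubsets.1 hAP).2
    have hvi : v ∈ E i := by
      by_contra hvi
      have hiS' : E i ⊆ S := (Finset.subset_insert_iff_of_notMem hvi).1 hiS
      rcases hiA with h | h
      · exact (hnot i hi hiS').1 (Finset.subset_erase.2 ⟨h, hvi⟩)
      · exact (hnot i hi hiS').2 (h.mono_right (Finset.erase_subset _ _))
    have hdiff : A \ E i ∈ properSubsets I E (S \ E i) := by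
      refine mem_properSubsets.2 ⟨?_, fun j hj hjS => ?_⟩
      · intro x hx
        have := hAS (Finset.mem_sdiff.1 hx).1
        grind
      · have hjS' : E j ⊆ S := hjS.trans Finset.sdiff_subset
        have := hnot j hj hjS'
        constructor
        · intro h
          exact this.1 fun x hx => by
            have := h hx
            have := hjS' hx
            grind
        · intro h
          refine this.2 (Finset.disjoint_left.2 fun x hx hxA => ?_)
          have := Finset.disjoint_left.1 h hx
          have := hjS hx
          grind
    refine Finset.mem_biUnion.2 ⟨i, by simp [hi, hvi, hiS], ?_⟩
    rcases hiA with h | h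
    · exact Finset.mem_union_right _ (Finset.mem_image.2 ⟨_, hdiff, Finset.sdiff_union_of_subset h⟩)
    · refine Finset.mem_union_left _ ?_
      rwa [Finset.sdiff_eq_self_of_disjoint h.symm] at hdiff
  refine (Finset.card_le_card hsub).trans ((Finset.card_union_le _ _).trans ?_)
  gcongr
  refine Finset.card_biUnion_le.trans (Finset.sum_le_sum fun i _ => ?_)
  refine (Finset.card_union_le _ _).trans ?_
  have := Finset.card_image_le (s := properSubsets I E (S \ E i)) (f := (· ∪ E i))
  omega

theorem pow_mul_card_properSubsets_le {S T U : Finset α}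
    (hgrow : ∀ S', S' ⊂ S → ∀ v ∉ S',
      (3 / 2 : ℝ) * (properSubsets I E S').card ≤ (properSubsets I E (insert v S')).card)
    (hTU : Disjoint T U) (hS : T ∪ U ⊆ S) :
    (3 / 2 : ℝ) ^ U.card * (properSubsets I E T).card ≤ (properSubsets I E (T ∪ U)).card := by
  induction U using Finset.induction_on with
  | empty => simp
  | insert u U hu ih =>
    have huT : u ∉ T := fun h => Finset.disjoint_left.1 hTU h (Finset.mem_insert_self _ _)
    have huTU : u ∉ T ∪ U := by simp [huT, hu]
    rw [Finset.union_insert] at hS ⊢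
    have h1 := ih (hTU.mono_right (Finset.subset_insert _ _)) ((Finset.subset_insert _ _).trans hS)
    have h2 := hgrow (T ∪ U) ((Finset.ssubset_insert huTU).trans_subset hS) u huTU
    rw [Finset.card_insert_of_notMem hu, pow_succ]
    linarith

theorem three_halves_mul_card_properSubsets_le
    (hw : ∀ v, ∑ i ∈ I with v ∈ E i, (2 / 3 : ℝ) ^ ((E i).card - 1) ≤ 1 / 4)
    (S : Finset α) : ∀ v ∉ S,
      (3 / 2 : ℝ) * (properSubsets I E S).card ≤ (properSubsets I E (insert v S)).card := by
  induction S using Finset.strongInduction with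
  | H S ih =>
    intro v hv
    have hmain : (2 : ℝ) * (properSubsets I E S).card ≤ (properSubsets I E (insert v S)).card +
        ∑ i ∈ I with v ∈ E i ∧ E i ⊆ insert v S, 2 * ((properSubsets I E (S \ E i)).card : ℝ) := by
      exact_mod_cast two_mul_card_properSubsets_le hv
    have hle : ∑ i ∈ I with v ∈ E i ∧ E i ⊆ insert v S,
        2 * ((properSubsets I E (S \ E i)).card : ℝ) ≤
        ∑ i ∈ I with v ∈ E i,
          (2 / 3 : ℝ) ^ ((E i).card - 1) * (2 * (properSubsets I E S).card) := by
      refine (Finset.sum_le_sum fun i hi => ?_).trans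
        (Finset.sum_le_sum_of_subset_of_nonneg ?_ fun _ _ _ => by positivity)
      · obtain ⟨-, hvi, hiS⟩ := Finset.mem_filter.1 hi
        have hU : S \ E i ∪ (E i).erase v = S := by
          ext x
          have := @hiS x
          by_cases hx : x = v <;> grind
        have := pow_mul_card_properSubsets_le (S := S) (T := S \ E i) (U := (E i).erase v) ih
          (Finset.disjoint_of_subset_right (Finset.erase_subset _ _) Finset.sdiff_disjoint) hU.le
        rw [hU, Finset.card_erase_of_mem hvi] at this
        have h1 : (2 / 3 : ℝ) ^ ((E i).card - 1) * (3 / 2 : ℝ) ^ ((E i).card - 1) = 1 := by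
          rw [← mul_pow]; norm_num
        have h2 := mul_le_mul_of_nonneg_left this
          (show (0 : ℝ) ≤ (2 / 3 : ℝ) ^ ((E i).card - 1) by positivity)
        rw [← mul_assoc, h1] at h2
        linarith
      · intro i hi
        simp only [Finset.mem_filter] at hi ⊢
        tauto
    rw [← Finset.sum_mul] at hle
    have := mul_le_mul_of_nonneg_right (hw v)
      (show (0 : ℝ) ≤ 2 * (properSubsets I E S).card by positivity)
    linarith

/-- A local lemma for hypergraph 2-coloring: if the edges through each vertex have small total
weight, then some set splits every edge. -/
theorem exists_splitting_set (hne : ∀ i ∈ I, (E i).Nonempty)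
    (hw : ∀ v, ∑ i ∈ I with v ∈ E i, (2 / 3 : ℝ) ^ ((E i).card - 1) ≤ 1 / 4) :
    ∃ A : Finset α, ∀ i ∈ I, (∃ x ∈ E i, x ∈ A) ∧ ∃ x ∈ E i, x ∉ A := by
  have hpos : 0 < (properSubsets I E (I.biUnion E)).card := by
    have h := pow_mul_card_properSubsets_le (I := I) (E := E) (T := ∅) (U := I.biUnion E)
      (fun S' _ => three_halves_mul_card_properSubsets_le hw S') (Finset.disjoint_empty_left _)
      subset_rfl
    have h0 : (properSubsets I E ∅).card = 1 := by
      rw [Finset.card_eq_one]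
      refine ⟨∅, Finset.ext fun A => ?_⟩
      rw [mem_properSubsets, Finset.subset_empty, Finset.mem_singleton]
      refine ⟨fun h => h.1, fun h => ⟨h, fun i hi hiE => ?_⟩⟩
      exact absurd (Finset.subset_empty.1 hiE) (hne i hi).ne_empty
    rw [h0, Finset.empty_union] at h
    have : (0 : ℝ) < (properSubsets I E (I.biUnion E)).card :=
      lt_of_lt_of_le (by positivity) h
    exact_mod_cast this
  obtain ⟨A, hA⟩ := Finset.card_pos.1 hpos
  refine ⟨A, fun i hi => ?_⟩
  obtain ⟨h1, h2⟩ := (mem_properSubsets.1 hA).2 i hi (Finset.subset_biUnion_of_mem E hi)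
  exact ⟨Finset.not_disjoint_iff.1 h2, Finset.not_subset.1 h1⟩

end Counting

section ComputablePredicates

variable {α : Type*} [Primcodable α]

theorem ComputablePred.inter {p q : α → Prop} (hp : ComputablePred p) (hq : ComputablePred q) :
    ComputablePred fun a => p a ∧ q a := by
  classical
  exact Computable.computablePred
    ((Primrec.and.to_comp.comp hp.decide hq.decide).of_eq fun a => by simp)

theorem ComputablePred.implies {p q : α → Prop} (hp : ComputablePred p) (hq : ComputablePred q) :
    ComputablePred fun a => p a → q a :=
  (hp.inter hq.not).not.of_eq fun a => by tauto

theorem ComputablePred.union {p q : α → Prop} (hp : ComputablePred p) (hq : ComputablePred q) :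
    ComputablePred fun a => p a ∨ q a :=
  (hp.not.inter hq.not).not.of_eq fun a => by tauto

theorem ComputablePred.forall_lt {p : α → ℕ → Prop}
    (hp : ComputablePred fun q : α × ℕ => p q.1 q.2) {n : α → ℕ} (hn : Computable n) :
    ComputablePred fun a => ∀ i < n a, p a i := by
  classical
  have h : Computable₂ fun (a : α) (q : ℕ × Bool) => q.2 && decide (p a q.1) :=
    Primrec.and.to_comp.comp (Computable.snd.comp Computable.snd)
      (hp.decide.comp (Computable.pair Computable.fst (Computable.fst.comp Computable.snd)))
  refine Computable.computablePred
    ((Computable.nat_rec hn (Computable.const true) h).of_eq fun a => ?_)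
  induction n a with
  | zero => simp
  | succ k ih =>
    refine (congrArg (· && decide (p a k)) ih).trans ?_
    rw [Bool.eq_iff_iff]
    simp only [Bool.and_eq_true, decide_eq_true_eq, Nat.forall_lt_succ_right]

theorem ComputablePred.exists_lt {p : α → ℕ → Prop}
    (hp : ComputablePred fun q : α × ℕ => p q.1 q.2) {n : α → ℕ} (hn : Computable n) :
    ComputablePred fun a => ∃ i < n a, p a i :=
  (ComputablePred.forall_lt (p := fun a i => ¬ p a i) hp.not hn).not.of_eq fun a => by simp

theorem ComputablePred.nat_eq {m n : α → ℕ} (hm : Computable m) (hn : Computable n) :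
    ComputablePred fun a => m a = n a :=
  (Primrec.eq (α := ℕ)).decide.to_comp.comp hm hn |>.computablePred

theorem ComputablePred.nat_lt {m n : α → ℕ} (hm : Computable m) (hn : Computable n) :
    ComputablePred fun a => m a < n a :=
  Primrec.nat_lt.decide.to_comp.comp hm hn |>.computablePred

theorem ComputablePred.nat_le {m n : α → ℕ} (hm : Computable m) (hn : Computable n) :
    ComputablePred fun a => m a ≤ n a :=
  Primrec.nat_le.decide.to_comp.comp hm hn |>.computablePred

theorem Computable.nat_count {p : α → ℕ → Prop} [∀ a, DecidablePred (p a)]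
    (hp : ComputablePred fun q : α × ℕ => p q.1 q.2) {n : α → ℕ} (hn : Computable n) :
    Computable fun a => Nat.count (p a) (n a) := by
  classical
  have h : Computable₂ fun (a : α) (q : ℕ × ℕ) => q.2 + bif (decide (p a q.1)) then 1 else 0 :=
    Primrec.nat_add.to_comp.comp (Computable.snd.comp Computable.snd)
      (Computable.cond
        (hp.decide.comp (Computable.pair Computable.fst (Computable.fst.comp Computable.snd)))
        (Computable.const 1) (Computable.const 0))
  refine (Computable.nat_rec hn (Computable.const 0) h).of_eq fun a => ?_
  induction n a with
  | zero => simp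
  | succ k ih =>
    refine (congrArg (· + bif decide (p a k) then 1 else 0) ih).trans ?_
    simp only [Nat.count_succ, Bool.cond_decide]

theorem Computable.sum_range {F : α → ℕ → ℕ} (hF : Computable₂ F) {n : α → ℕ}
    (hn : Computable n) : Computable fun a => ∑ i ∈ Finset.range (n a), F a i := by
  have h : Computable₂ fun (a : α) (q : ℕ × ℕ) => q.2 + F a q.1 :=
    Primrec.nat_add.to_comp.comp (Computable.snd.comp Computable.snd)
      (hF.comp Computable.fst (Computable.fst.comp Computable.snd))
  refine (Computable.nat_rec hn (Computable.const 0) h).of_eq fun a => ?_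
  induction n a with
  | zero => simp
  | succ k ih => simp [ih, Finset.sum_range_succ]

theorem primrec_two_pow : Primrec fun n : ℕ => 2 ^ n := by
  refine (Primrec.nat_rec₁ (f := fun _ m => 2 * m) 1
    (Primrec.nat_mul.comp (Primrec.const 2) Primrec.snd)).of_eq fun n => ?_
  induction n with
  | zero => rfl
  | succ k ih => exact (congrArg (2 * ·) ih).trans (pow_succ' 2 k).symm

theorem primrec_testBit : Primrec₂ Nat.testBit := by
  refine ((Primrec.eq (α := ℕ)).decide.comp (Primrec.nat_mod.comp (Primrec.nat_div.comp Primrec.fst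
    (primrec_two_pow.comp Primrec.snd)) (Primrec.const 2)) (Primrec.const 1)).of_eq fun a => ?_
  rw [Nat.testBit_eq_decide_div_mod_eq]

theorem Computable.testBit {m n : α → ℕ} (hm : Computable m) (hn : Computable n) :
    Computable fun a => (m a).testBit (n a) :=
  primrec_testBit.to_comp.comp hm hn

theorem ComputablePred.testBit_eq {m n : α → ℕ} (hm : Computable m) (hn : Computable n)
    (b : Bool) : ComputablePred fun a => (m a).testBit (n a) = b :=
  (Primrec.eq (α := Bool)).decide.to_comp.comp (Computable.testBit hm hn) (Computable.const b)
    |>.computablePred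

/-- The bit code of the finset with a given code is primitive recursive in that code. -/
theorem primrec_sum_two_pow : Primrec fun s : Finset ℕ => ∑ i ∈ s, 2 ^ i := by
  have key : ∀ (l : List ℕ) (n a : ℕ),
      (l.foldl (fun (q : ℕ × ℕ) m => (m + q.1 + 1, q.2 + 2 ^ (m + q.1))) (n, a)).2 =
        a + ((Denumerable.raise' l n).map (2 ^ ·)).sum := by
    intro l
    induction l with
    | nil => simp [Denumerable.raise']
    | cons m l ih =>
      intro n a
      simp only [List.foldl_cons, ih, Denumerable.raise', List.map_cons, List.sum_cons]
      ring
  have hstep : Primrec₂ fun (_ : ℕ) (q : (ℕ × ℕ) × ℕ) =>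
      (q.2 + q.1.1 + 1, q.1.2 + 2 ^ (q.2 + q.1.1)) := by
    have h : Primrec fun q : ℕ × ((ℕ × ℕ) × ℕ) => q.2.2 + q.2.1.1 :=
      Primrec.nat_add.comp (Primrec.snd.comp Primrec.snd)
        (Primrec.fst.comp (Primrec.fst.comp Primrec.snd))
    exact Primrec.pair (Primrec.succ.comp h) (Primrec.nat_add.comp
      (Primrec.snd.comp (Primrec.fst.comp Primrec.snd)) (primrec_two_pow.comp h))
  rw [Primrec.ofNat_iff]
  refine (Primrec.snd.comp (Primrec.list_foldl (Primrec.ofNat (List ℕ))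
    (Primrec.const ((0, 0) : ℕ × ℕ)) hstep)).of_eq fun n => ?_
  rw [key, zero_add]
  change _ = ∑ i ∈ Finset.map (Denumerable.eqv ℕ).symm.toEmbedding
    (Denumerable.raise'Finset (Denumerable.ofNat (List ℕ) n) 0), 2 ^ i
  rw [Finset.sum_map]
  rfl

end ComputablePredicates

/-! A finite coloring is a pair `s = (length, bits)`: the color of `n < s.1` is bit `n` of `s.2`.
A finite set of naturals is coded by the number `t` whose bits are its characteristic function. -/

section Construction

variable (f : ℕ → ℕ → ℕ) (K G : ℕ → ℕ)

/-- The encoded result of running the `e`-th partial recursive function on `m` for `k` steps: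
`0` if there is no output yet, and the successor of the output otherwise. -/
def stepEval (e k m : ℕ) : ℕ :=
  Encodable.encode (Nat.Partrec.Code.evaln k (Denumerable.ofNat Nat.Partrec.Code e) m)

/-- Some `f x y` with `x` in the set coded by `t` has received the color `b`. -/
def Hits (s : ℕ × ℕ) (t y : ℕ) (b : Bool) : Prop :=
  ∃ x < t, t.testBit x = true ∧ f x y < s.1 ∧ s.2.testBit (f x y) = b

/-- The number `y` is outside the set coded by `t` and `f x y` takes both colors as `x` ranges
over this set. -/
def Splits (s : ℕ × ℕ) (t y : ℕ) : Prop :=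
  t.testBit y = false ∧ Hits f s t y true ∧ Hits f s t y false

/-- One of the finite sets enumerated by the `e`-th partial recursive function consists of numbers
that split the set coded by `t`. -/
def Refuted (s : ℕ × ℕ) (e t : ℕ) : Prop :=
  ∃ m < s.1, ¬ stepEval e s.1 m = 0 ∧ ∀ y < stepEval e s.1 m,
    (stepEval e s.1 m - 1).testBit y = true → Splits f s t y

/-- The set coded by `t` has `K e` elements. -/
def HasSize (e t : ℕ) : Prop :=
  Nat.count (fun x => t.testBit x = true) t = K e

/-- `t` codes the first set of size `K e` that is not refuted. -/
def Current (s : ℕ × ℕ) (e t : ℕ) : Prop :=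
  (HasSize K e t ∧ ¬ Refuted f s e t) ∧ ∀ t' < t, HasSize K e t' → Refuted f s e t'

/-- At `s`, the pair of `e` and `y` is responsible for the still uncolored numbers `f x y`, where
`x` is in the current set coded by `t`. -/
def Active (s : ℕ × ℕ) (e t y : ℕ) : Prop :=
  (Current f K s e t ∧ t.testBit y = false) ∧ ∀ x < t, t.testBit x = true → s.1 ≤ f x y

/-- Some `f x y` with `x` in the set coded by `t` is below `n`. -/
def Touches (n t y : ℕ) : Prop :=
  ∃ x < t, t.testBit x = true ∧ f x y < n

/-- At least half of the `x` in the set coded by `t` have `f x y` not below `n`. -/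
def Roomy (n e t y : ℕ) : Prop :=
  K e ≤ 2 * Nat.count (fun x => t.testBit x = true ∧ n ≤ f x y) t

/-- Every responsibility taken on at `s` and started before `s'` is fulfilled at `s'` or leaves
enough room. -/
def Promising (s s' : ℕ × ℕ) : Prop :=
  ∀ e < s.1, ∀ t < s.1, ∀ y < G s'.1, Active f K s e t y → Touches f s'.1 t y →
    Splits f s' t y ∨ Roomy f K s'.1 e t y

/-- Every responsibility taken on at `o` and started before `s` is fulfilled at `s'`. -/
def Fulfills (o s s' : ℕ × ℕ) : Prop :=
  ∀ e < o.1, ∀ t < o.1, ∀ y < G s.1, Active f K o e t y → Touches f s.1 t y → Splits f s' t y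

/-- `s'` properly extends the finite coloring `s`. -/
def Extends (s s' : ℕ × ℕ) : Prop :=
  s.1 < s'.1 ∧ ∀ n < s.1, s'.2.testBit n = s.2.testBit n

/-- `s'` is an admissible continuation of the finite coloring `s` with predecessor `o`. -/
def IsNext (o s s' : ℕ × ℕ) : Prop :=
  Extends s s' ∧ Fulfills f K G o s s' ∧ Promising f K G s s'

end Construction

section Effectivity

variable {α : Type*} [Primcodable α] {f : ℕ → ℕ → ℕ} {K G : ℕ → ℕ}
  {o s s' : α → ℕ × ℕ} {e t y : α → ℕ}

open ComputablePred

theorem Computable.stepEval {k m : α → ℕ} (he : Computable e) (hk : Computable k)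
    (hm : Computable m) : Computable fun a => stepEval (e a) (k a) (m a) :=
  Computable.encode.comp (Nat.Partrec.Code.primrec_evaln.to_comp.comp
    (((hk.pair ((Primrec.ofNat _).to_comp.comp he))).pair hm))

theorem computablePred_hits (hf : Computable₂ f) (hs : Computable s) (ht : Computable t)
    (hy : Computable y) (b : Bool) : ComputablePred fun a => Hits f (s a) (t a) (y a) b := by
  have hfx : Computable fun q : α × ℕ => f q.2 (y q.1) :=
    hf.comp Computable.snd (hy.comp Computable.fst)
  exact exists_lt ((testBit_eq (ht.comp Computable.fst) Computable.snd true).inter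
    ((nat_lt hfx (Computable.fst.comp (hs.comp Computable.fst))).inter
      (testBit_eq (Computable.snd.comp (hs.comp Computable.fst)) hfx b))) ht

theorem computablePred_splits (hf : Computable₂ f) (hs : Computable s) (ht : Computable t)
    (hy : Computable y) : ComputablePred fun a => Splits f (s a) (t a) (y a) :=
  (testBit_eq ht hy false).inter
    ((computablePred_hits hf hs ht hy true).inter (computablePred_hits hf hs ht hy false))

theorem computablePred_refuted (hf : Computable₂ f) (hs : Computable s) (he : Computable e)
    (ht : Computable t) : ComputablePred fun a => Refuted f (s a) (e a) (t a) := by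
  have hE : Computable fun q : α × ℕ => stepEval (e q.1) (s q.1).1 q.2 :=
    Computable.stepEval (he.comp Computable.fst)
      (Computable.fst.comp (hs.comp Computable.fst)) Computable.snd
  have hfst : Computable fun q : (α × ℕ) × ℕ => q.1.1 := Computable.fst.comp Computable.fst
  refine exists_lt ((nat_eq hE (Computable.const 0)).not.inter
    (forall_lt (implies (testBit_eq (Primrec.pred.to_comp.comp (hE.comp Computable.fst))
      Computable.snd true) (computablePred_splits hf (hs.comp hfst) (ht.comp hfst)
        Computable.snd)) hE)) (Computable.fst.comp hs)

theorem computablePred_hasSize (hK : Computable K) (he : Computable e) (ht : Computable t) :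
    ComputablePred fun a => HasSize K (e a) (t a) :=
  nat_eq (Computable.nat_count (testBit_eq (ht.comp Computable.fst) Computable.snd true) ht)
    (hK.comp he)

theorem computablePred_current (hf : Computable₂ f) (hK : Computable K) (hs : Computable s)
    (he : Computable e) (ht : Computable t) :
    ComputablePred fun a => Current f K (s a) (e a) (t a) :=
  ((computablePred_hasSize hK he ht).inter (computablePred_refuted hf hs he ht).not).inter
    (forall_lt (implies (computablePred_hasSize hK (he.comp Computable.fst) Computable.snd)
      (computablePred_refuted hf (hs.comp Computable.fst) (he.comp Computable.fst)
        Computable.snd)) ht)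

theorem computablePred_active (hf : Computable₂ f) (hK : Computable K) (hs : Computable s)
    (he : Computable e) (ht : Computable t) (hy : Computable y) :
    ComputablePred fun a => Active f K (s a) (e a) (t a) (y a) :=
  ((computablePred_current hf hK hs he ht).inter (testBit_eq ht hy false)).inter
    (forall_lt (implies (testBit_eq (ht.comp Computable.fst) Computable.snd true)
      (nat_le (Computable.fst.comp (hs.comp Computable.fst))
        (hf.comp Computable.snd (hy.comp Computable.fst)))) ht)

theorem computablePred_touches {n : α → ℕ} (hf : Computable₂ f) (hn : Computable n)
    (ht : Computable t) (hy : Computable y) :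
    ComputablePred fun a => Touches f (n a) (t a) (y a) :=
  exists_lt ((testBit_eq (ht.comp Computable.fst) Computable.snd true).inter
    (nat_lt (hf.comp Computable.snd (hy.comp Computable.fst)) (hn.comp Computable.fst))) ht

theorem computablePred_roomy {n : α → ℕ} (hf : Computable₂ f) (hK : Computable K)
    (hn : Computable n) (he : Computable e) (ht : Computable t) (hy : Computable y) :
    ComputablePred fun a => Roomy f K (n a) (e a) (t a) (y a) :=
  nat_le (hK.comp he) (Primrec.nat_mul.to_comp.comp (Computable.const 2)
    (Computable.nat_count ((testBit_eq (ht.comp Computable.fst) Computable.snd true).inter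
      (nat_le (hn.comp Computable.fst)
        (hf.comp Computable.snd (hy.comp Computable.fst)))) ht))

theorem computablePred_promising (hf : Computable₂ f) (hK : Computable K) (hG : Computable G)
    (hs : Computable s) (hs' : Computable s') :
    ComputablePred fun a => Promising f K G (s a) (s' a) := by
  have h1 : Computable fun q : ((α × ℕ) × ℕ) × ℕ => q.1.1.1 :=
    Computable.fst.comp (Computable.fst.comp Computable.fst)
  have h2 : Computable fun q : ((α × ℕ) × ℕ) × ℕ => q.1.1.2 :=
    Computable.snd.comp (Computable.fst.comp Computable.fst)
  have h3 : Computable fun q : ((α × ℕ) × ℕ) × ℕ => q.1.2 :=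
    Computable.snd.comp Computable.fst
  have hs1 := Computable.fst.comp hs
  refine forall_lt (forall_lt (forall_lt (implies
    (computablePred_active hf hK (hs.comp h1) h2 h3 Computable.snd) (implies
    (computablePred_touches hf (Computable.fst.comp (hs'.comp h1)) h3 Computable.snd)
    ((computablePred_splits hf (hs'.comp h1) h3 Computable.snd).union
    (computablePred_roomy hf hK (Computable.fst.comp (hs'.comp h1)) h2 h3 Computable.snd))))
    ?_) ?_) hs1
  · exact hG.comp (Computable.fst.comp (hs'.comp (Computable.fst.comp Computable.fst)))
  · exact hs1.comp Computable.fst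

theorem computablePred_fulfills (hf : Computable₂ f) (hK : Computable K) (hG : Computable G)
    (ho : Computable o) (hs : Computable s) (hs' : Computable s') :
    ComputablePred fun a => Fulfills f K G (o a) (s a) (s' a) := by
  have h1 : Computable fun q : ((α × ℕ) × ℕ) × ℕ => q.1.1.1 :=
    Computable.fst.comp (Computable.fst.comp Computable.fst)
  have h2 : Computable fun q : ((α × ℕ) × ℕ) × ℕ => q.1.1.2 :=
    Computable.snd.comp (Computable.fst.comp Computable.fst)
  have h3 : Computable fun q : ((α × ℕ) × ℕ) × ℕ => q.1.2 :=
    Computable.snd.comp Computable.fst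
  have ho1 := Computable.fst.comp ho
  refine forall_lt (forall_lt (forall_lt (implies
    (computablePred_active hf hK (ho.comp h1) h2 h3 Computable.snd) (implies
    (computablePred_touches hf (Computable.fst.comp (hs.comp h1)) h3 Computable.snd)
    (computablePred_splits hf (hs'.comp h1) h3 Computable.snd)))
    ?_) ?_) ho1
  · exact hG.comp (Computable.fst.comp (hs.comp (Computable.fst.comp Computable.fst)))
  · exact ho1.comp Computable.fst

theorem computablePred_extends (hs : Computable s) (hs' : Computable s') :
    ComputablePred fun a => Extends (s a) (s' a) := by
  refine (nat_lt (Computable.fst.comp hs) (Computable.fst.comp hs')).inter (forall_lt ?_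
    (Computable.fst.comp hs))
  exact ((Primrec.eq (α := Bool)).decide.to_comp.comp
    (Computable.testBit (Computable.snd.comp (hs'.comp Computable.fst)) Computable.snd)
    (Computable.testBit (Computable.snd.comp (hs.comp Computable.fst)) Computable.snd)
    ).computablePred

theorem computablePred_isNext (hf : Computable₂ f) (hK : Computable K) (hG : Computable G)
    (ho : Computable o) (hs : Computable s) (hs' : Computable s') :
    ComputablePred fun a => IsNext f K G (o a) (s a) (s' a) :=
  (computablePred_extends hs hs').inter ((computablePred_fulfills hf hK hG ho hs hs').inter
    (computablePred_promising hf hK hG hs hs'))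

/-- If admissible continuations always exist, there is a computable sequence of finite colorings
built from them. -/
theorem exists_computable_sequence (hf : Computable₂ f) (hK : Computable K) (hG : Computable G)
    (hnext : ∀ o s, Promising f K G o s → ∃ s', IsNext f K G o s s') :
    ∃ S : ℕ → ℕ × ℕ, Computable S ∧ (∀ i, Extends (S i) (S (i + 1))) ∧
      ∀ i, Fulfills f K G (S i) (S (i + 1)) (S (i + 2)) := by
  classical
  let R : (ℕ × ℕ) × (ℕ × ℕ) → ℕ → Prop := fun p n =>
    Promising f K G p.1 p.2 → IsNext f K G p.1 p.2 (Denumerable.ofNat (ℕ × ℕ) n)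
  have hR : ∀ p, ∃ n, R p n := fun p => by
    by_cases h : Promising f K G p.1 p.2
    · obtain ⟨s', hs'⟩ := hnext _ _ h
      exact ⟨Encodable.encode s', fun _ => by rwa [Denumerable.ofNat_encode]⟩
    · exact ⟨0, fun h' => absurd h' h⟩
  have hRc : ComputablePred fun q : ((ℕ × ℕ) × (ℕ × ℕ)) × ℕ => R q.1 q.2 := by
    have h1 : Computable fun q : ((ℕ × ℕ) × (ℕ × ℕ)) × ℕ => q.1.1 :=
      Computable.fst.comp Computable.fst
    have h2 : Computable fun q : ((ℕ × ℕ) × (ℕ × ℕ)) × ℕ => q.1.2 :=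
      Computable.snd.comp Computable.fst
    exact implies (computablePred_promising hf hK hG h1 h2)
      (computablePred_isNext hf hK hG h1 h2 ((Primrec.ofNat _).to_comp.comp Computable.snd))
  let N : (ℕ × ℕ) × (ℕ × ℕ) → ℕ × ℕ := fun p => Denumerable.ofNat (ℕ × ℕ) (Nat.find (hR p))
  have hN : Computable N := (Primrec.ofNat _).to_comp.comp (Computable.find hRc hR)
  have hNspec : ∀ p, Promising f K G p.1 p.2 → IsNext f K G p.1 p.2 (N p) :=
    fun p => Nat.find_spec (hR p)
  let Q : ℕ → (ℕ × ℕ) × (ℕ × ℕ) := fun i => Nat.rec ((0, 0), (0, 0)) (fun _ p => (p.2, N p)) i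
  have hQ : Computable Q := by
    refine Computable.nat_rec (f := fun i : ℕ => i)
      (g := fun _ : ℕ => (((0, 0), (0, 0)) : (ℕ × ℕ) × (ℕ × ℕ)))
      (h := fun (_ : ℕ) (q : ℕ × ((ℕ × ℕ) × (ℕ × ℕ))) => (q.2.2, N q.2))
      Computable.id (Computable.const _) ?_
    have h : Computable fun q : ℕ × (ℕ × ((ℕ × ℕ) × (ℕ × ℕ))) => q.2.2 :=
      Computable.snd.comp Computable.snd
    exact (Computable.snd.comp h).pair (hN.comp h)
  have hQ' : ∀ i, Promising f K G (Q i).1 (Q i).2 := by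
    intro i
    induction i with
    | zero => intro e he; exact absurd he (Nat.not_lt_zero _)
    | succ i ih => exact (hNspec _ ih).2.2
  exact ⟨fun i => (Q i).2, Computable.snd.comp hQ, fun i => (hNspec _ (hQ' i)).1,
    fun i => (hNspec _ (hQ' (i + 1))).2.1⟩

end Effectivity

section Existence

variable {f : ℕ → ℕ → ℕ} {K G : ℕ → ℕ} {b : ℕ}

theorem testBit_sum_two_pow (F : Finset ℕ) (n : ℕ) :
    (∑ i ∈ F, 2 ^ i).testBit n = true ↔ n ∈ F := by
  rw [← Nat.mem_bitIndices, ← List.mem_toFinset, Finset.toFinset_bitIndices_sum_two_pow]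

theorem lt_of_testBit {t x : ℕ} (h : t.testBit x = true) : x < t :=
  Nat.lt_two_pow_self.trans_le (Nat.ge_two_pow_of_testBit h)

theorem Current.unique {s : ℕ × ℕ} {e t t' : ℕ} (h : Current f K s e t)
    (h' : Current f K s e t') : t = t' := by
  rcases lt_trichotomy t t' with hlt | heq | hlt
  · exact absurd (h'.2 t hlt h.1.1) h.1.2
  · exact heq
  · exact absurd (h.2 t' hlt h'.1.1) h'.1.2

theorem Hits.mono {s s' : ℕ × ℕ} (hs : s.1 ≤ s'.1)
    (hbit : ∀ n < s.1, s'.2.testBit n = s.2.testBit n) {t y : ℕ} {c : Bool}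
    (h : Hits f s t y c) : Hits f s' t y c := by
  obtain ⟨x, hxt, hx, hlt, hc⟩ := h
  exact ⟨x, hxt, hx, hlt.trans_le hs, (hbit _ hlt).trans hc⟩

theorem Splits.mono {s s' : ℕ × ℕ} (hs : s.1 ≤ s'.1)
    (hbit : ∀ n < s.1, s'.2.testBit n = s.2.testBit n) {t y : ℕ}
    (h : Splits f s t y) : Splits f s' t y :=
  ⟨h.1, h.2.1.mono hs hbit, h.2.2.mono hs hbit⟩

/-- The values `f x y` in `[m, n)` with `x` in the set coded by `t`. -/
def blockValues (f : ℕ → ℕ → ℕ) (m n t y : ℕ) : Finset ℕ :=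
  ((Finset.range t).filter fun x => t.testBit x = true ∧ m ≤ f x y ∧ f x y < n).image (f · y)

theorem mem_blockValues {m n t y v : ℕ} : v ∈ blockValues f m n t y ↔
    ∃ x < t, t.testBit x = true ∧ m ≤ f x y ∧ f x y < n ∧ f x y = v := by
  simp [blockValues, and_assoc]

theorem card_fiber_le (hb : ∀ x y, x ≠ y → ∀ S : Finset ℕ,
    (∀ z ∈ S, z ≠ x ∧ f x z = f x y) → S.card ≤ b) {S : Finset ℕ} {x v : ℕ}
    (hS : ∀ y ∈ S, y ≠ x ∧ f x y = v) : S.card ≤ b := by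
  rcases S.eq_empty_or_nonempty with rfl | ⟨y, hy⟩
  · simp
  · exact hb x y (hS y hy).1.symm S fun z hz => ⟨(hS z hz).1, (hS z hz).2.trans (hS y hy).2.symm⟩

theorem card_le_mul_card_blockValues (hsym : ∀ x y, f x y = f y x)
    (hb : ∀ x y, x ≠ y → ∀ S : Finset ℕ, (∀ z ∈ S, z ≠ x ∧ f x z = f x y) → S.card ≤ b)
    {m n t y : ℕ} (hy : t.testBit y = false) :
    ((Finset.range t).filter fun x => t.testBit x = true ∧ m ≤ f x y ∧ f x y < n).card ≤
      b * (blockValues f m n t y).card := by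
  refine Finset.card_le_mul_card_image _ _ fun v _ => card_fiber_le hb (x := y) (v := v) ?_
  intro x hx
  simp only [Finset.mem_filter] at hx
  refine ⟨?_, (hsym y x).trans hx.2⟩
  rintro rfl
  simp [hy] at hx

theorem card_active_le (hb : ∀ x y, x ≠ y → ∀ S : Finset ℕ,
      (∀ z ∈ S, z ≠ x ∧ f x z = f x y) → S.card ≤ b) {s : ℕ × ℕ} {m n e v : ℕ}
    {J : Finset (ℕ × ℕ)}
    (hJ : ∀ p ∈ J, Active f K s e p.1 p.2 ∧ v ∈ blockValues f m n p.1 p.2) :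
    J.card ≤ K e * b := by
  rcases J.eq_empty_or_nonempty with rfl | ⟨⟨t, y₀⟩, h₀⟩
  · simp
  have ht : ∀ p ∈ J, p.1 = t := fun p hp => (hJ p hp).1.1.1.unique (hJ _ h₀).1.1.1
  have hinj : Set.InjOn Prod.snd (J : Set (ℕ × ℕ)) := fun p hp q hq h =>
    Prod.ext ((ht p hp).trans (ht q hq).symm) h
  rw [← Finset.card_image_of_injOn hinj]
  have hsize : ((Finset.range t).filter fun x => t.testBit x = true).card = K e := by
    rw [← Nat.count_eq_card_filter_range]
    exact (hJ _ h₀).1.1.1.1.1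
  rw [← hsize]
  have hsub : J.image Prod.snd ⊆
      ((Finset.range t).filter fun x => t.testBit x = true).biUnion fun x =>
        (J.image Prod.snd).filter fun y => y ≠ x ∧ f x y = v := by
    intro y hy
    obtain ⟨p, hp, rfl⟩ := Finset.mem_image.1 hy
    obtain ⟨x, hxt, hx, -, -, hv⟩ := mem_blockValues.1 (hJ p hp).2
    rw [ht p hp] at hxt hx
    refine Finset.mem_biUnion.2 ⟨x, by simp [hxt, hx], Finset.mem_filter.2 ⟨hy, ?_, hv⟩⟩
    intro h
    have := (hJ p hp).1.1.2
    rw [ht p hp, h, hx] at this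
    exact absurd this (by simp)
  refine (Finset.card_le_card hsub).trans (Finset.card_biUnion_le_card_mul _ _ _ fun x _ => ?_)
  exact card_fiber_le hb (x := x) (v := v) fun y hy => (Finset.mem_filter.1 hy).2

theorem exists_isNext (hsym : ∀ x y, f x y = f y x)
    (hb : ∀ x y, x ≠ y → ∀ S : Finset ℕ, (∀ z ∈ S, z ≠ x ∧ f x z = f x y) → S.card ≤ b)
    {C : ℕ} (hK : ∀ e, K e = 2 * (b + 1) * (e + C + 1))
    (hsum : ∀ n, ∑ e ∈ Finset.range n, (K e * b : ℝ) * (2 / 3) ^ (e + C) ≤ 1 / 8)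
    (o s : ℕ × ℕ) (hos : Promising f K G o s) : ∃ s', IsNext f K G o s s' := by
  classical
  obtain ⟨N, hsN, hN⟩ : ∃ N, s.1 < N ∧ ∀ x < o.1, ∀ y < G s.1, f x y < N := by
    refine ⟨s.1 + 1 + ∑ x ∈ Finset.range o.1, ∑ y ∈ Finset.range (G s.1), (f x y + 1), by omega,
      fun x hx y hy => ?_⟩
    have h1 := Finset.single_le_sum (f := fun x => ∑ y ∈ Finset.range (G s.1), (f x y + 1))
      (fun _ _ => Nat.zero_le _) (Finset.mem_range.2 hx)
    have h2 := Finset.single_le_sum (f := fun y => f x y + 1)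
      (fun _ _ => Nat.zero_le _) (Finset.mem_range.2 hy)
    omega
  let T : Finset (ℕ × ℕ) := Finset.range (o.1 + s.1) ×ˢ Finset.range (G s.1 + G N)
  let st : Bool → ℕ × ℕ := fun q => bif q then s else o
  let E : (Bool × ℕ) × (ℕ × ℕ) → Finset ℕ := fun i => blockValues f s.1 N i.2.1 i.2.2
  let I : Finset ((Bool × ℕ) × (ℕ × ℕ)) :=
    ((Finset.univ ×ˢ Finset.range (o.1 + s.1)) ×ˢ T).filter fun i =>
      Active f K (st i.1.1) i.1.2 i.2.1 i.2.2 ∧ i.1.2 + C + 1 ≤ (E i).card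
  have hw : ∀ v, ∑ i ∈ I with v ∈ E i, (2 / 3 : ℝ) ^ ((E i).card - 1) ≤ 1 / 4 := by
    intro v
    have hmaps : ∀ i ∈ I.filter (fun i => v ∈ E i),
        i.1 ∈ (Finset.univ : Finset Bool) ×ˢ Finset.range (o.1 + s.1) := fun i hi =>
      (Finset.mem_product.1 (Finset.mem_filter.1 (Finset.mem_filter.1 hi).1).1).1
    rw [← Finset.sum_fiberwise_of_maps_to hmaps]
    have hle : ∀ p ∈ (Finset.univ : Finset Bool) ×ˢ Finset.range (o.1 + s.1),
        ∑ i ∈ (I.filter fun i => v ∈ E i) with i.1 = p, (2 / 3 : ℝ) ^ ((E i).card - 1) ≤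
          (K p.2 * b : ℝ) * (2 / 3) ^ (p.2 + C) := by
      intro p _
      have hmem : ∀ i ∈ ((I.filter fun i => v ∈ E i).filter fun i => i.1 = p),
          i.1 = p ∧ Active f K (st p.1) p.2 i.2.1 i.2.2 ∧ p.2 + C + 1 ≤ (E i).card ∧
            v ∈ E i := by
        intro i hi
        have h1 := Finset.mem_filter.1 hi
        have h2 := Finset.mem_filter.1 h1.1
        have h3 := (Finset.mem_filter.1 h2.1).2
        rw [h1.2] at h3
        exact ⟨h1.2, h3.1, h3.2, h2.2⟩
      have hcard : ((I.filter fun i => v ∈ E i).filter fun i => i.1 = p).card ≤ K p.2 * b := by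
        rw [← Finset.card_image_of_injOn (f := Prod.snd)]
        · refine card_active_le hb (s := st p.1) (m := s.1) (n := N) (v := v) fun q hq => ?_
          obtain ⟨i, hi, rfl⟩ := Finset.mem_image.1 hq
          exact ⟨(hmem i hi).2.1, (hmem i hi).2.2.2⟩
        · intro i hi j hj h
          exact Prod.ext ((hmem i hi).1.trans (hmem j hj).1.symm) h
      calc _ ≤ ∑ i ∈ (I.filter fun i => v ∈ E i) with i.1 = p, (2 / 3 : ℝ) ^ (p.2 + C) := by
            refine Finset.sum_le_sum fun i hi => ?_
            have := (hmem i hi).2.2.1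
            exact pow_le_pow_of_le_one (by norm_num) (by norm_num) (by omega)
        _ ≤ _ := by
            rw [Finset.sum_const, nsmul_eq_mul]
            have : (((I.filter fun i => v ∈ E i).filter fun i => i.1 = p).card : ℝ) ≤
              K p.2 * b := by exact_mod_cast hcard
            gcongr
    refine (Finset.sum_le_sum hle).trans ?_
    rw [Finset.sum_product]
    simp only [Fintype.sum_bool]
    linarith [hsum (o.1 + s.1)]
  have hne : ∀ i ∈ I, (E i).Nonempty := fun i hi =>
    Finset.card_pos.1 (by have := (Finset.mem_filter.1 hi).2.2; omega)
  obtain ⟨A, hA⟩ := exists_splitting_set hne hw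
  let F : Finset ℕ := ((Finset.range s.1).filter fun n => s.2.testBit n = true) ∪
    A.filter fun n => s.1 ≤ n
  let s' : ℕ × ℕ := (N, ∑ i ∈ F, 2 ^ i)
  have hold : ∀ n < s.1, s'.2.testBit n = s.2.testBit n := by
    intro n hn
    rw [Bool.eq_iff_iff, testBit_sum_two_pow]
    simp only [F, Finset.mem_union, Finset.mem_filter, Finset.mem_range]
    have : ¬ s.1 ≤ n := by omega
    tauto
  have hnew : ∀ n, s.1 ≤ n → (s'.2.testBit n = true ↔ n ∈ A) := by
    intro n hn
    rw [testBit_sum_two_pow]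
    simp only [F, Finset.mem_union, Finset.mem_filter, Finset.mem_range]
    have : ¬ n < s.1 := by omega
    tauto
  have hsplit : ∀ q e t y, Active f K (st q) e t y → e < o.1 + s.1 → t < o.1 + s.1 →
      y < G s.1 + G N → K e ≤ 2 * ((Finset.range t).filter fun x =>
        t.testBit x = true ∧ s.1 ≤ f x y ∧ f x y < N).card → Splits f s' t y := by
    intro q e t y hact he ht hy hcard
    have hE : e + C + 1 ≤ (blockValues f s.1 N t y).card := by
      have h1 := card_le_mul_card_blockValues hsym hb (m := s.1) (n := N) hact.1.2
      rw [hK e] at hcard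
      have h2 : (b + 1) * (e + C + 1) ≤ (b + 1) * (blockValues f s.1 N t y).card := by
        nlinarith
      exact Nat.le_of_mul_le_mul_left h2 (Nat.succ_pos b)
    have hi : ((q, e), (t, y)) ∈ I := by
      refine Finset.mem_filter.2 ⟨?_, hact, hE⟩
      simp [T, he, ht, hy]
    obtain ⟨⟨v, hv, hvA⟩, w, hw, hwA⟩ := hA _ hi
    obtain ⟨x, hxt, hx, hsx, hxN, rfl⟩ := mem_blockValues.1 hv
    obtain ⟨z, hzt, hz, hsz, hzN, rfl⟩ := mem_blockValues.1 hw
    refine ⟨hact.1.2, ⟨x, hxt, hx, hxN, (hnew _ hsx).2 hvA⟩, ⟨z, hzt, hz, hzN, ?_⟩⟩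
    rw [← Bool.not_eq_true, hnew _ hsz]
    exact hwA
  refine ⟨s', ⟨hsN, hold⟩, ?_, ?_⟩
  · intro e he t ht y hy hact htouch
    rcases hos e he t ht y hy hact htouch with h | h
    · exact h.mono hsN.le hold
    · refine hsplit false e t y hact (by omega) (by omega) (by omega) (h.trans_eq ?_)
      rw [Nat.count_eq_card_filter_range]
      congr 2
      refine Finset.filter_congr fun x hx => ?_
      have := hN x ((Finset.mem_range.1 hx).trans ht) y hy
      tauto
  · intro e he t ht y hy hact _
    by_cases h : Roomy f K N e t y
    · exact Or.inr h
    · refine Or.inl (hsplit true e t y hact (by omega) (by omega) (by simp only [s'] at hy; omega) ?_)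
      have hsize : ((Finset.range t).filter fun x => t.testBit x = true).card = K e := by
        rw [← Nat.count_eq_card_filter_range]
        exact hact.1.1.1.1
      rw [Roomy, Nat.count_eq_card_filter_range, not_le] at h
      rw [← Finset.card_filter_add_card_filter_not (fun x => N ≤ f x y), Finset.filter_filter,
        Finset.filter_filter] at hsize
      have : ((Finset.range t).filter fun x => t.testBit x = true ∧ ¬ N ≤ f x y) =
          (Finset.range t).filter fun x => t.testBit x = true ∧ s.1 ≤ f x y ∧ f x y < N := by
        refine Finset.filter_congr fun x hx => ?_
        have h1 := hact.2 x (Finset.mem_range.1 hx)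
        rw [not_le]
        exact ⟨fun h => ⟨h.1, h1 h.1, h.2⟩, fun h => ⟨h.1, h.2.2⟩⟩
      rw [this] at hsize
      omega

/-- Sizes for which the total weight of the edges through a vertex is small. -/
theorem exists_sum_weights_le (b : ℕ) : ∃ C : ℕ, ∀ n, ∑ e ∈ Finset.range n,
    (((2 * (b + 1) * (e + C + 1) : ℕ) : ℝ) * b) * (2 / 3) ^ (e + C) ≤ 1 / 8 := by
  let u : ℕ → ℝ := fun k => (((2 * (b + 1) * (k + 1) : ℕ) : ℝ) * b) * (2 / 3) ^ k
  have hu : Summable u := by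
    have h1 : Summable fun k : ℕ => (k : ℝ) ^ 1 * (2 / 3 : ℝ) ^ k :=
      summable_pow_mul_geometric_of_norm_lt_one 1 (by norm_num)
    have h0 : Summable fun k : ℕ => (2 / 3 : ℝ) ^ k :=
      summable_geometric_of_lt_one (by norm_num) (by norm_num)
    refine ((h1.add h0).mul_left (2 * (b + 1) * b : ℝ)).congr fun k => ?_
    simp only [u]
    push_cast
    ring
  obtain ⟨C, hC⟩ := ((tendsto_sum_nat_add u).eventually
    (ge_mem_nhds (show (0 : ℝ) < 1 / 8 by norm_num))).exists
  refine ⟨C, fun n => ?_⟩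
  refine le_trans ?_ hC
  exact ((summable_nat_add_iff C).2 hu).sum_le_tsum (Finset.range n) fun i _ => by positivity

end Existence

section Verification

open Filter

variable {f : ℕ → ℕ → ℕ} {K G : ℕ → ℕ} {S : ℕ → ℕ × ℕ}

theorem extends_of_le (hS : ∀ i, Extends (S i) (S (i + 1))) {i j : ℕ} (hij : i ≤ j) :
    (S i).1 ≤ (S j).1 ∧ ∀ n < (S i).1, (S j).2.testBit n = (S i).2.testBit n := by
  induction j, hij using Nat.le_induction with
  | base => exact ⟨le_rfl, fun _ _ => rfl⟩
  | succ j _ ih => exact ⟨ih.1.trans (hS j).1.le, fun n hn =>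
      ((hS j).2 n (hn.trans_le ih.1)).trans (ih.2 n hn)⟩

theorem strictMono_length (hS : ∀ i, Extends (S i) (S (i + 1))) : StrictMono fun i => (S i).1 :=
  strictMono_nat_of_lt_succ fun i => (hS i).1

theorem testBit_eq_limit (hS : ∀ i, Extends (S i) (S (i + 1))) {i n : ℕ} (hn : n < (S i).1) :
    (S i).2.testBit n = (S (n + 1)).2.testBit n := by
  rcases le_total i (n + 1) with h | h
  · exact ((extends_of_le hS h).2 n hn).symm
  · exact (extends_of_le hS h).2 n ((strictMono_length hS).le_apply (x := n + 1))

/-- Every computable function is enumerated by some index. -/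
theorem exists_stepEval_eq {F : ℕ → ℕ} (hF : Computable F) :
    ∃ e, (∀ k m, stepEval e k m = 0 ∨ stepEval e k m = F m + 1) ∧
      ∀ m, ∀ᶠ k in atTop, stepEval e k m = F m + 1 := by
  obtain ⟨c, hc⟩ := Nat.Partrec.Code.exists_code.1 (Partrec.nat_iff.1 hF)
  refine ⟨Encodable.encode c, fun k m => ?_, fun m => ?_⟩
  · rw [stepEval, Denumerable.ofNat_encode]
    cases h : Nat.Partrec.Code.evaln k c m with
    | none => exact Or.inl rfl
    | some v =>
      have hv : v ∈ c.eval m := Nat.Partrec.Code.evaln_sound h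
      rw [hc] at hv
      obtain rfl : v = F m := by simpa using hv
      exact Or.inr rfl
  · have hv : F m ∈ c.eval m := by rw [hc]; simp
    obtain ⟨k, hk⟩ := Nat.Partrec.Code.evaln_complete.1 hv
    filter_upwards [eventually_ge_atTop k] with k' hk'
    have h := Nat.Partrec.Code.evaln_mono hk' hk
    rw [stepEval, Denumerable.ofNat_encode, Option.mem_def.1 h]
    rfl

theorem Refuted.exists_splits {D : ℕ → Finset ℕ} {e : ℕ}
    (he : ∀ k m, stepEval e k m = 0 ∨ stepEval e k m = ∑ y ∈ D m, 2 ^ y + 1)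
    {s : ℕ × ℕ} {t : ℕ} (h : Refuted f s e t) : ∃ m, ∀ y ∈ D m, Splits f s t y := by
  obtain ⟨m, -, h0, h⟩ := h
  rw [(he _ _).resolve_left h0] at h
  refine ⟨m, fun y hy => ?_⟩
  have hbit := (testBit_sum_two_pow (D m) y).2 hy
  exact h y ((lt_of_testBit hbit).trans (Nat.lt_succ_self _)) hbit

theorem eventually_refuted (hS : ∀ i, Extends (S i) (S (i + 1))) {D : ℕ → Finset ℕ} {e : ℕ}
    (he : ∀ m, ∀ᶠ k in atTop, stepEval e k m = ∑ y ∈ D m, 2 ^ y + 1) {t m : ℕ}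
    (h : ∀ y ∈ D m, ∃ j, Splits f (S j) t y) : ∀ᶠ i in atTop, Refuted f (S i) e t := by
  have hlen := (strictMono_length hS).tendsto_atTop
  have hsplit : ∀ᶠ i in atTop, ∀ y ∈ D m, Splits f (S i) t y := by
    refine (eventually_all_finset (D m)).2 fun y hy => ?_
    obtain ⟨j, hj⟩ := h y hy
    filter_upwards [eventually_ge_atTop j] with i hi
    exact hj.mono (extends_of_le hS hi).1 (extends_of_le hS hi).2
  filter_upwards [hsplit, hlen.eventually (he m), hlen.eventually (eventually_gt_atTop m)]
    with i h1 h2 h3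
  refine ⟨m, h3, by omega, fun y _ hy => h1 y ?_⟩
  rw [h2, Nat.add_sub_cancel, testBit_sum_two_pow] at hy
  exact hy

/-- If the set coded by `t` is current from some stage on, then all large numbers split it. -/
theorem exists_splits_of_current (hS : ∀ i, Extends (S i) (S (i + 1)))
    (hful : ∀ i, Fulfills f K G (S i) (S (i + 1)) (S (i + 2)))
    (hG : ∀ x n y, x ≤ n → G n ≤ y → n < f x y) {i₀ e t y : ℕ} (hK : 0 < K e)
    (hcur : ∀ i ≥ i₀, Current f K (S i) e t) (he : e < (S i₀).1) (ht : t < (S i₀).1)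
    (hty : t.testBit y = false) (hy : G (S i₀).1 ≤ y) : ∃ j, Splits f (S j) t y := by
  by_contra! hno
  have hact : ∀ i ≥ i₀, Active f K (S i) e t y := by
    intro i hi
    induction i, hi using Nat.le_induction with
    | base => exact ⟨⟨hcur _ le_rfl, hty⟩, fun x hx _ => (hG x _ y (hx.trans ht).le hy).le⟩
    | succ i hi ih =>
      have hlen := (extends_of_le hS hi).1
      refine ⟨⟨hcur _ (hi.trans i.le_succ), hty⟩, fun x hx hbit => ?_⟩
      by_contra! hlt
      refine hno (i + 2) (hful i e (he.trans_le hlen) t (ht.trans_le hlen) y ?_ ih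
        ⟨x, hx, hbit, hlt⟩)
      by_contra! hle
      have := hG x _ y ((hx.trans ht).le.trans (hlen.trans (hS i).1.le)) hle
      omega
  have hsize : Nat.count (fun x => t.testBit x = true) t = K e := (hcur _ le_rfl).1.1
  obtain ⟨x, hx⟩ : ∃ x, x ∈ (Finset.range t).filter fun x => t.testBit x = true := by
    refine Finset.card_pos.1 ?_
    rwa [← Nat.count_eq_card_filter_range, hsize]
  obtain ⟨hxt, hbit⟩ := Finset.mem_filter.1 hx
  have h1 := (hact (i₀ + (f x y + 1)) (Nat.le_add_right _ _)).2 x (Finset.mem_range.1 hxt) hbit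
  have h2 : i₀ + (f x y + 1) ≤ (S (i₀ + (f x y + 1))).1 := (strictMono_length hS).le_apply
  omega

theorem exists_forall_le_of_disjoint {D : ℕ → Finset ℕ}
    (hD : ∀ i j, i ≠ j → Disjoint (D i) (D j)) (B : ℕ) : ∃ m, ∀ y ∈ D m, B ≤ y := by
  by_contra! h
  choose y hy hlt using h
  refine not_injective_infinite_finite (fun m => (⟨y m, hlt m⟩ : Fin B)) fun i j hij => ?_
  by_contra hne
  have heq : y i = y j := congrArg Fin.val hij
  exact Finset.disjoint_left.1 (hD i j hne) (hy i) (heq ▸ hy j)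

/-- Along the construction, every set of the right size is eventually refuted by a disjoint
computable sequence of finite sets. -/
theorem eventually_refuted_of_disjoint (hS : ∀ i, Extends (S i) (S (i + 1)))
    (hful : ∀ i, Fulfills f K G (S i) (S (i + 1)) (S (i + 2)))
    (hG : ∀ x n y, x ≤ n → G n ≤ y → n < f x y) {D : ℕ → Finset ℕ}
    (hD : ∀ i j, i ≠ j → Disjoint (D i) (D j)) {e : ℕ} (hK : 0 < K e)
    (he : ∀ k m, stepEval e k m = 0 ∨ stepEval e k m = ∑ y ∈ D m, 2 ^ y + 1)
    (he' : ∀ m, ∀ᶠ k in atTop, stepEval e k m = ∑ y ∈ D m, 2 ^ y + 1) (t : ℕ)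
    (ht : HasSize K e t) : ∀ᶠ i in atTop, Refuted f (S i) e t := by
  induction t using Nat.strong_induction_on with
  | _ t ih =>
  by_contra hnot
  have hnever : ∀ i, ¬ Refuted f (S i) e t := fun i hi => by
    obtain ⟨m, hm⟩ := hi.exists_splits he
    exact hnot (eventually_refuted hS he' fun y hy => ⟨i, hm y hy⟩)
  have hcur : ∀ᶠ i in atTop, Current f K (S i) e t := by
    have hall : ∀ᶠ i in atTop, ∀ t' ∈ Finset.range t, HasSize K e t' → Refuted f (S i) e t' := by
      refine (eventually_all_finset _).2 fun t' ht' => ?_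
      by_cases hsize : HasSize K e t'
      · exact (ih t' (Finset.mem_range.1 ht') hsize).mono fun _ h _ => h
      · exact Eventually.of_forall fun _ h => absurd h hsize
    filter_upwards [hall] with i hi
    exact ⟨⟨ht, hnever i⟩, fun t' ht' => hi t' (Finset.mem_range.2 ht')⟩
  obtain ⟨i₁, hi₁⟩ := eventually_atTop.1 hcur
  let i₀ := i₁ + e + t + 1
  have hlen : i₀ ≤ (S i₀).1 := (strictMono_length hS).le_apply
  obtain ⟨m, hm⟩ := exists_forall_le_of_disjoint hD (G (S i₀).1 + t)
  refine hnot (eventually_refuted hS he' (m := m) fun y hy => ?_)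
  have hyt := hm y hy
  refine exists_splits_of_current hS hful hG (i₀ := i₀) hK (fun i hi => hi₁ i (by omega))
    (by omega) (by omega) ?_ (by omega)
  rw [← Bool.not_eq_true]
  intro h
  have := lt_of_testBit h
  omega

end Verification

/-- For any symmetric addition-like `f`, there is a computable instance `c` of `RT^f_2`
all of whose solutions are hyperimmune: for every computable sequence of pairwise
disjoint nonempty finite sets `D`, some `D i` misses the solution entirely. -/
theorem stmt_7 (f : ℕ → ℕ → ℕ) (hsym : ∀ x y, f x y = f y x) (hf : AdditionLike f) :
    ∃ c : ℕ → Bool, Computable c ∧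
      ∀ H : Set ℕ, H.Infinite →
        (∃ i : Bool, ∀ x ∈ H, ∀ y ∈ H, x ≠ y → c (f x y) = i) →
        ∀ D : ℕ → Finset ℕ, Computable D →
          (∀ i j, i ≠ j → Disjoint (D i) (D j)) →
          (∀ i, (D i).Nonempty) →
          ∃ i, (D i : Set ℕ) ∩ H = ∅ := by
  obtain ⟨hfc, ⟨g, hgc, hg⟩, b, hb⟩ := hf
  obtain ⟨C, hC⟩ := exists_sum_weights_le b
  let K : ℕ → ℕ := fun e => 2 * (b + 1) * (e + C + 1)
  let G : ℕ → ℕ := fun n => ∑ x ∈ Finset.range (n + 1), (g x n + 1)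
  have hKc : Computable K := (Primrec.nat_mul.comp (Primrec.const _) (Primrec.succ.comp
    (Primrec.nat_add.comp Primrec.id (Primrec.const C)))).to_comp
  have hGc : Computable G := Computable.sum_range (F := fun n x => g x n + 1)
    (Computable.succ.comp (hgc.comp Computable.snd Computable.fst)) Computable.succ
  have hG : ∀ x n y, x ≤ n → G n ≤ y → n < f x y := by
    intro x n y hx hy
    have h := Finset.single_le_sum (f := fun x => g x n + 1) (fun _ _ => Nat.zero_le _)
      (Finset.mem_range.2 (Nat.lt_succ_of_le hx))
    exact hg x n y (Nat.lt_of_succ_le (h.trans hy))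
  obtain ⟨S, hSc, hS, hful⟩ := exists_computable_sequence hfc hKc hGc
    fun o s => exists_isNext (G := G) hsym hb (fun _ => rfl) hC o s
  refine ⟨fun n => (S (n + 1)).2.testBit n, Computable.testBit
    (Computable.snd.comp (hSc.comp Computable.succ)) Computable.id, ?_⟩
  rintro H hH ⟨a, ha⟩ D hDc hD -
  by_contra! hmeet
  obtain ⟨e, he, he'⟩ := exists_stepEval_eq (primrec_sum_two_pow.to_comp.comp hDc)
  obtain ⟨F, hFH, hFcard⟩ := hH.exists_subset_card_eq (K e)
  have hmem := testBit_sum_two_pow F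
  have hsize : HasSize K e (∑ x ∈ F, 2 ^ x) := by
    rw [HasSize, Nat.count_eq_card_filter_range, ← hFcard]
    congr 1
    ext x
    simp only [Finset.mem_filter, Finset.mem_range, hmem]
    exact ⟨fun h => h.2, fun h => ⟨lt_of_testBit ((hmem x).2 h), h⟩⟩
  obtain ⟨i, hi⟩ := (eventually_refuted_of_disjoint hS hful hG hD
    (show 0 < K e by positivity) he he' _ hsize).exists
  obtain ⟨m, hm⟩ := hi.exists_splits he
  obtain ⟨y, hyD, hyH⟩ := hmeet m
  obtain ⟨hyF, hits⟩ := hm y hyD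
  have hcolor : ∀ q, Hits f (S i) (∑ x ∈ F, 2 ^ x) y q → q = a := by
    rintro q ⟨x, -, hx, hlt, rfl⟩
    rw [testBit_eq_limit hS hlt]
    refine ha x (hFH ((hmem x).1 hx)) y hyH ?_
    rintro rfl
    exact Bool.noConfusion (hx.symm.trans hyF)
  exact Bool.noConfusion ((hcolor _ hits.1).trans (hcolor _ hits.2).symm)
end

section
/- Every computable instance of HT^{=2}_2 has a Π⁰₂ solution: for every computable coloring c : ℕ → Bool there exist a computable relation R : ℕ → ℕ → ℕ → Bool such that the set H = {n | ∀ a, ∃ b, R n a b = true} is infinite and is a solution to c, i.e., there is a fixed color i with c (x + y) = i for all x, y ∈ H with x ≠ y. -/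
namespace HindmanSums

/-- A finite list of numbers, most recent first, each with a prescribed color. -/
abbrev Path := List (ℕ × Bool)

/-- Adding `y` to any number on the path gives the color prescribed for that number. -/
def fits (c : ℕ → Bool) (L : Path) (y : ℕ) : Bool :=
  L.foldr (fun p r => (c (y + p.1) == p.2) && r) true

/-- Change the most recent `true` to `false`, dropping everything more recent. -/
def backtrack (L : Path) : Path :=
  List.rec [] (fun p L' r => bif p.2 then (p.1, false) :: L' else r) L

/-- One step of the construction, `e` being the answer to the question whether some `y ≥ t`
fits the current path. -/
def step (c : ℕ → Bool) (e : Bool) (t : ℕ) (L : Path) : Path :=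
  bif e then (bif fits c L t then (t, true) :: L else L) else backtrack L

open Classical in
/-- The path reached at time `t` when all questions are answered correctly. -/
noncomputable def path (c : ℕ → Bool) : ℕ → Path
  | 0 => []
  | t + 1 => step c (decide (∃ y, t ≤ y ∧ fits c (path c t) y = true)) t (path c t)

open Classical in
lemma path_succ_of_exists {c : ℕ → Bool} {t : ℕ}
    (h : ∃ y, t ≤ y ∧ fits c (path c t) y = true) :
    path c (t + 1) = bif fits c (path c t) t then (t, true) :: path c t else path c t := by
  rw [path, step, decide_eq_true h, cond_true]

open Classical in
lemma path_succ_of_not_exists {c : ℕ → Bool} {t : ℕ}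
    (h : ¬ ∃ y, t ≤ y ∧ fits c (path c t) y = true) :
    path c (t + 1) = backtrack (path c t) := by
  rw [path, step, decide_eq_false h, cond_false]

/-- Search below `w` for some `y ≥ t` fitting `L`. -/
def search (c : ℕ → Bool) (w t : ℕ) (L : Path) : Bool :=
  (List.range w).foldr (fun y r => (decide (t ≤ y) && fits c L y) || r) false

/-- The path reached at time `t` when questions are answered by searching below `w`. -/
def approx (c : ℕ → Bool) (w t : ℕ) : Path :=
  Nat.rec [] (fun s L => step c (search c w s L) s L) t

@[simp] lemma fits_nil (c : ℕ → Bool) (y : ℕ) : fits c [] y = true := rfl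

@[simp] lemma fits_cons (c : ℕ → Bool) (p : ℕ × Bool) (L : Path) (y : ℕ) :
    fits c (p :: L) y = true ↔ c (y + p.1) = p.2 ∧ fits c L y = true := by
  simp [fits]

lemma fits_iff (c : ℕ → Bool) (L : Path) (y : ℕ) :
    fits c L y = true ↔ ∀ p ∈ L, c (y + p.1) = p.2 := by
  induction L with
  | nil => simp
  | cons p L ih => rw [fits_cons, ih]; simp

lemma fits_congr {c d : ℕ → Bool} {L : Path} {y : ℕ}
    (h : ∀ p ∈ L, d (y + p.1) = c (y + p.1)) : fits d L y = fits c L y := by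
  rw [Bool.eq_iff_iff, fits_iff, fits_iff]
  exact forall₂_congr fun p hp => by rw [h p hp]

lemma search_iff (c : ℕ → Bool) (w t : ℕ) (L : Path) :
    search c w t L = true ↔ ∃ y < w, t ≤ y ∧ fits c L y = true := by
  have key : ∀ l : List ℕ, l.foldr (fun y r => (decide (t ≤ y) && fits c L y) || r) false = true ↔
      ∃ y ∈ l, t ≤ y ∧ fits c L y = true := by
    intro l
    induction l with
    | nil => simp
    | cons a l ih =>
      rw [List.foldr_cons, Bool.or_eq_true, ih]
      simp
  rw [search, key]
  simp only [List.mem_range]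

@[simp] lemma backtrack_nil : backtrack [] = [] := rfl

@[simp] lemma backtrack_cons_true (a : ℕ) (L : Path) :
    backtrack ((a, true) :: L) = (a, false) :: L := rfl

@[simp] lemma backtrack_cons_false (a : ℕ) (L : Path) :
    backtrack ((a, false) :: L) = backtrack L := rfl

lemma length_backtrack_le (L : Path) : (backtrack L).length ≤ L.length := by
  induction L with
  | nil => simp
  | cons p L ih =>
    obtain ⟨a, _ | _⟩ := p
    · simp; omega
    · simp

lemma not_suffix_backtrack {L : Path} (hL : L ≠ []) : ¬ L <:+ backtrack L := by
  intro h
  have h1 := h.eq_of_length (le_antisymm h.length_le (length_backtrack_le L))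
  match L, hL with
  | (a, true) :: L, _ => simp at h1
  | (a, false) :: L, _ =>
    have := length_backtrack_le L
    rw [backtrack_cons_false] at h1
    rw [← h1] at this
    simp at this

lemma suffix_backtrack {p : ℕ × Bool} {S L : Path} (h : p :: S <:+ L) :
    p :: S <:+ backtrack L ∨ backtrack L = backtrack (p :: S) := by
  induction L with
  | nil => simp at h
  | cons q L ih =>
    rcases List.suffix_cons_iff.1 h with h' | h'
    · right; rw [h']
    · obtain ⟨a, _ | _⟩ := q
      · exact ih h'
      · exact Or.inl (h'.trans (List.suffix_cons (a, false) L))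

/-- The numbers on a path decrease, and each gives the colors prescribed by the later entries. -/
def Coherent (c : ℕ → Bool) (L : Path) : Prop :=
  L.Pairwise fun p q => q.1 < p.1 ∧ c (p.1 + q.1) = q.2

lemma coherent_backtrack {c : ℕ → Bool} {L : Path} (h : Coherent c L) :
    Coherent c (backtrack L) := by
  induction L with
  | nil => exact h
  | cons p L ih =>
    obtain ⟨a, _ | _⟩ := p
    · exact ih (List.pairwise_cons.1 h).2
    · exact List.pairwise_cons.2 (List.pairwise_cons.1 h)

lemma exists_mem_of_mem_backtrack {L : Path} {p : ℕ × Bool} (h : p ∈ backtrack L) :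
    p ∈ L ∨ p.2 = false ∧ (p.1, true) ∈ L := by
  induction L with
  | nil => simp at h
  | cons q L ih =>
    obtain ⟨a, _ | _⟩ := q
    · rcases ih h with h | h
      · exact Or.inl (List.mem_cons_of_mem _ h)
      · exact Or.inr ⟨h.1, List.mem_cons_of_mem _ h.2⟩
    · rw [backtrack_cons_true, List.mem_cons] at h
      rcases h with rfl | h
      · simp
      · exact Or.inl (List.mem_cons_of_mem _ h)

lemma mem_step {c : ℕ → Bool} {e : Bool} {t : ℕ} {L : Path} {p : ℕ × Bool}
    (h : p ∈ step c e t L) :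
    p = (t, true) ∨ p ∈ L ∨ p.2 = false ∧ (p.1, true) ∈ L := by
  unfold step at h
  cases e
  · exact Or.inr (exists_mem_of_mem_backtrack h)
  · cases hf : fits c L t <;> simp [hf] at h <;> tauto

lemma lt_of_mem_path {c : ℕ → Bool} {t : ℕ} {p : ℕ × Bool} (h : p ∈ path c t) : p.1 < t := by
  induction t generalizing p with
  | zero => simp [path] at h
  | succ t ih =>
    rcases mem_step h with rfl | h | h
    · simp
    · exact (ih h).trans (Nat.lt_succ_self t)
    · exact (ih h.2).trans (Nat.lt_succ_self t)

lemma coherent_path (c : ℕ → Bool) (t : ℕ) : Coherent c (path c t) := by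
  induction t with
  | zero => exact List.Pairwise.nil
  | succ t ih =>
    by_cases he : ∃ y, t ≤ y ∧ fits c (path c t) y = true
    · rw [path_succ_of_exists he]
      cases hf : fits c (path c t) t
      · exact ih
      · exact List.pairwise_cons.2
          ⟨fun q hq => ⟨lt_of_mem_path hq, (fits_iff _ _ _).1 hf q hq⟩, ih⟩
    · rw [path_succ_of_not_exists he]
      exact coherent_backtrack ih

/-- Whenever an entry has been changed to `false`, only finitely many numbers fit the path
ending in that entry with its original color. -/
def Justified (c : ℕ → Bool) : Path → Prop
  | [] => True
  | p :: L => (p.2 = false → {y | fits c ((p.1, true) :: L) y = true}.Finite) ∧ Justified c L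

lemma justified_backtrack {c : ℕ → Bool} {L : Path} (h : Justified c L)
    (hfin : {y | fits c L y = true}.Finite) :
    Justified c (backtrack L) ∧ backtrack L ≠ [] := by
  induction L with
  | nil => simp [Set.infinite_univ.not_finite] at hfin
  | cons p L ih =>
    obtain ⟨a, _ | _⟩ := p
    · refine ih h.2 (((h.1 rfl).union hfin).subset fun y hy => ?_)
      cases hc : c (y + a)
      · exact Or.inr (by simpa [hc] using hy)
      · exact Or.inl (by simpa [hc] using hy)
    · exact ⟨⟨fun _ => hfin, h.2⟩, by simp⟩

lemma finite_of_not_exists {c : ℕ → Bool} {t : ℕ} {L : Path}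
    (h : ¬ ∃ y, t ≤ y ∧ fits c L y = true) : {y | fits c L y = true}.Finite :=
  (Set.finite_lt_nat t).subset fun y hy => by
    by_contra hlt
    exact h ⟨y, not_lt.1 hlt, hy⟩

lemma justified_path (c : ℕ → Bool) (t : ℕ) : Justified c (path c t) := by
  induction t with
  | zero => trivial
  | succ t ih =>
    by_cases he : ∃ y, t ≤ y ∧ fits c (path c t) y = true
    · rw [path_succ_of_exists he]
      cases hf : fits c (path c t) t
      · exact ih
      · exact ⟨by simp, ih⟩
    · rw [path_succ_of_not_exists he]
      exact (justified_backtrack ih (finite_of_not_exists he)).1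

/-- The next path extends the current one, or is obtained by backtracking. -/
lemma path_succ_cases (c : ℕ → Bool) (t : ℕ) :
    path c t <:+ path c (t + 1) ∨
      path c (t + 1) = backtrack (path c t) ∧ backtrack (path c t) ≠ [] := by
  by_cases he : ∃ y, t ≤ y ∧ fits c (path c t) y = true
  · rw [path_succ_of_exists he]
    left
    cases hf : fits c (path c t) t
    · exact List.suffix_rfl
    · exact List.suffix_cons _ _
  · rw [path_succ_of_not_exists he]
    exact Or.inr ⟨rfl, (justified_backtrack (justified_path c t) (finite_of_not_exists he)).2⟩

lemma suffix_path_succ {c : ℕ → Bool} {t : ℕ} {p : ℕ × Bool} {S : Path}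
    (h : p :: S <:+ path c t) (hS : S <:+ path c (t + 1)) :
    p :: S <:+ path c (t + 1) ∨ p.2 = true ∧ (p.1, false) :: S <:+ path c (t + 1) := by
  rcases path_succ_cases c t with h1 | ⟨h1, h2⟩
  · exact Or.inl (h.trans h1)
  · rw [h1] at hS ⊢
    rcases suffix_backtrack h with h3 | h3
    · exact Or.inl h3
    · rw [h3] at hS h2 ⊢
      obtain ⟨a, _ | _⟩ := p
      · exfalso
        rw [backtrack_cons_false] at hS h2
        refine not_suffix_backtrack ?_ hS
        rintro rfl
        exact h2 rfl
      · exact Or.inr ⟨rfl, List.suffix_rfl⟩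

/-- From time `T` on, `S` remains a final segment of the path. -/
def Stable (c : ℕ → Bool) (S : Path) (T : ℕ) : Prop := ∀ t, T ≤ t → S <:+ path c t

lemma stable_of_persist {c : ℕ → Bool} {S : Path} {T : ℕ} (h : S <:+ path c T)
    (hs : ∀ t, T ≤ t → S <:+ path c t → S <:+ path c (t + 1)) : Stable c S T :=
  fun _ ht => Nat.le_induction h (fun t ht ih => hs t ht ih) _ ht

lemma exists_cons_suffix {c : ℕ → Bool} {S : Path} {T : ℕ} (h : Stable c S T) :
    ∃ t, T ≤ t ∧ ∃ p, p :: S <:+ path c t := by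
  by_contra hno
  have heq : ∀ t, T ≤ t → path c t = S := by
    intro t ht
    obtain ⟨l, hl⟩ := h t ht
    rcases List.eq_nil_or_concat l with rfl | ⟨l', p, rfl⟩
    · simpa using hl.symm
    · exact (hno ⟨t, ht, p, l', by rw [← hl]; simp⟩).elim
  have hex : ∃ y, T ≤ y ∧ fits c (path c T) y = true := by
    by_contra he
    have h2 := (justified_backtrack (justified_path c T) (finite_of_not_exists he)).2
    have h1 := path_succ_of_not_exists he
    rw [heq T le_rfl] at h1 h2
    rw [heq _ (Nat.le_succ T)] at h1
    refine not_suffix_backtrack (L := S) ?_ (by rw [← h1])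
    rintro rfl
    exact h2 rfl
  obtain ⟨y, hy, hf⟩ := hex
  have h1 : path c (y + 1) = (y, true) :: path c y := by
    rw [heq T le_rfl, ← heq y hy] at hf
    rw [path_succ_of_exists ⟨y, le_rfl, hf⟩, hf, cond_true]
  exact hno ⟨y + 1, by omega, (y, true), by rw [h1, heq y hy]⟩

lemma exists_stable_cons {c : ℕ → Bool} {S : Path} {T : ℕ} (h : Stable c S T) :
    ∃ p T', Stable c (p :: S) T' := by
  have hfalse : ∀ a t, T ≤ t → (a, false) :: S <:+ path c t → Stable c ((a, false) :: S) t :=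
    fun a t ht hs => stable_of_persist hs fun s hts hs' => by
      simpa using suffix_path_succ hs' (h (s + 1) (by omega))
  obtain ⟨t, ht, ⟨a, _ | _⟩, hp⟩ := exists_cons_suffix h
  · exact ⟨_, t, hfalse a t ht hp⟩
  · by_cases hall : Stable c ((a, true) :: S) t
    · exact ⟨_, t, hall⟩
    · have : ∃ s, t ≤ s ∧ (a, true) :: S <:+ path c s ∧ ¬ (a, true) :: S <:+ path c (s + 1) := by
        by_contra hno
        push Not at hno
        exact hall (stable_of_persist hp hno)
      obtain ⟨s, hs, h1, h2⟩ := this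
      have h3 := (suffix_path_succ h1 (h (s + 1) (by omega))).resolve_left h2
      exact ⟨_, s + 1, hfalse a (s + 1) (by omega) h3.2⟩

lemma exists_stable_length (c : ℕ → Bool) (n : ℕ) : ∃ S T, Stable c S T ∧ S.length = n := by
  induction n with
  | zero => exact ⟨[], 0, fun _ _ => List.nil_suffix, rfl⟩
  | succ n ih =>
    obtain ⟨S, T, h, rfl⟩ := ih
    obtain ⟨p, T', h'⟩ := exists_stable_cons h
    exact ⟨_, T', h', rfl⟩

lemma true_mem_path_of_le {c : ℕ → Bool} {x t t' : ℕ} (hx : x < t) (ht : t ≤ t')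
    (h : (x, true) ∈ path c t') : (x, true) ∈ path c t := by
  induction t', ht using Nat.le_induction with
  | base => exact h
  | succ s hs ih =>
    rcases mem_step h with h | h | h
    · simp only [Prod.mk.injEq] at h; omega
    · exact ih h
    · simp at h

lemma mem_path_of_le {c : ℕ → Bool} {x t t' : ℕ} (hx : x < t) (ht : t ≤ t')
    (h : ∃ i, (x, i) ∈ path c t') : ∃ i, (x, i) ∈ path c t := by
  induction t', ht using Nat.le_induction with
  | base => exact h
  | succ s hs ih =>
    obtain ⟨i, h⟩ := h
    rcases mem_step h with h | h | h
    · simp only [Prod.mk.injEq] at h; omega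
    · exact ih ⟨i, h⟩
    · exact ih ⟨true, h.2⟩

/-- The numbers that stay on the path forever. -/
def survivors (c : ℕ → Bool) : Set ℕ := {x | ∀ t, x < t → ∃ i, (x, i) ∈ path c t}

/-- The numbers that stay on the path forever with color `true`. -/
def trueSurvivors (c : ℕ → Bool) : Set ℕ := {x | ∀ t, x < t → (x, true) ∈ path c t}

lemma infinite_survivors (c : ℕ → Bool) : (survivors c).Infinite := by
  intro hfin
  obtain ⟨S, T, hS, hlen⟩ := exists_stable_length c (hfin.toFinset.card + 1)
  have hnodup : (S.map Prod.fst).Nodup := by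
    rw [List.Nodup, List.pairwise_map]
    exact ((coherent_path c T).sublist (hS T le_rfl).sublist).imp fun h => h.1.ne'
  have hsub : (S.map Prod.fst).toFinset ⊆ hfin.toFinset := by
    intro x hx
    rw [List.mem_toFinset, List.mem_map] at hx
    obtain ⟨⟨x, i⟩, hx, rfl⟩ := hx
    rw [Set.Finite.mem_toFinset]
    intro t ht
    exact mem_path_of_le ht (le_max_left t T)
      ⟨i, (hS _ (le_max_right t T)).subset hx⟩
  have := Finset.card_le_card hsub
  rw [List.toFinset_card_of_nodup hnodup, List.length_map] at this
  omega

lemma color_add_of_mem_path {c : ℕ → Bool} {x y t : ℕ} {i j : Bool} (hxy : x < y)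
    (hx : (x, i) ∈ path c t) (hy : (y, j) ∈ path c t) : c (x + y) = i := by
  have key : ∀ L : Path, Coherent c L → (x, i) ∈ L → (y, j) ∈ L → c (x + y) = i := by
    intro L
    induction L with
    | nil => simp
    | cons p L ih =>
      intro hL hx hy
      obtain ⟨h1, h2⟩ := List.pairwise_cons.1 hL
      rcases List.mem_cons.1 hx with rfl | hx'
      · rcases List.mem_cons.1 hy with hy | hy
        · simp only [Prod.mk.injEq] at hy; omega
        · have := (h1 _ hy).1
          simp only at this; omega
      · rcases List.mem_cons.1 hy with rfl | hy
        · rw [add_comm]; exact (h1 _ hx').2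
        · exact ih h2 hx' hy
  exact key _ (coherent_path c t) hx hy

lemma eq_of_lt_imp {c : ℕ → Bool} {i : Bool} {A : Set ℕ}
    (h : ∀ x ∈ A, ∀ y ∈ A, x < y → c (x + y) = i) :
    ∀ x ∈ A, ∀ y ∈ A, x ≠ y → c (x + y) = i := by
  intro x hx y hy hne
  rcases lt_or_gt_of_ne hne with hlt | hlt
  · exact h x hx y hy hlt
  · rw [add_comm]; exact h y hy x hx hlt

lemma color_add_of_mem_trueSurvivors {c : ℕ → Bool} :
    ∀ x ∈ trueSurvivors c, ∀ y ∈ trueSurvivors c, x ≠ y → c (x + y) = true :=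
  eq_of_lt_imp fun _ hx y hy hlt =>
    color_add_of_mem_path hlt (hx (y + 1) (by omega)) (hy (y + 1) (by omega))

lemma color_add_of_mem_survivors_diff {c : ℕ → Bool} :
    ∀ x ∈ survivors c \ trueSurvivors c, ∀ y ∈ survivors c \ trueSurvivors c,
      x ≠ y → c (x + y) = false := by
  refine eq_of_lt_imp fun x hx y hy hlt => ?_
  obtain ⟨t, hxt, ht⟩ : ∃ t, x < t ∧ (x, true) ∉ path c t := by
    simpa [trueSurvivors] using hx.2
  obtain ⟨i, hi⟩ := hx.1 (max t (y + 1)) (by omega)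
  obtain ⟨j, hj⟩ := hy.1 (max t (y + 1)) (by omega)
  cases i
  · exact color_add_of_mem_path hlt hi hj
  · exact (ht (true_mem_path_of_le hxt (le_max_left _ _) hi)).elim

lemma eventually_approx_eq {c : ℕ → Bool} {d : ℕ → ℕ → Bool}
    (hd : ∀ w n, n < 2 * w → d w n = c n) (t : ℕ) :
    ∃ W, ∀ w, W ≤ w → approx (d w) w t = path c t := by
  induction t with
  | zero => exact ⟨0, fun _ _ => rfl⟩
  | succ t ih =>
    obtain ⟨W, hW⟩ := ih
    have hfits : ∀ w y, t < w → y < w → fits (d w) (path c t) y = fits c (path c t) y :=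
      fun w y ht hy => fits_congr fun p hp => hd _ _ (by have := lt_of_mem_path hp; omega)
    have hstep : ∀ w, W ≤ w → t < w →
        (search (d w) w t (path c t) = true ↔ ∃ y, t ≤ y ∧ fits c (path c t) y = true) →
        approx (d w) w (t + 1) = path c (t + 1) := by
      intro w hw ht hiff
      change step (d w) (search (d w) w t (approx (d w) w t)) t (approx (d w) w t) = _
      rw [hW w hw, step, hfits w t ht ht]
      by_cases he : ∃ y, t ≤ y ∧ fits c (path c t) y = true
      · rw [hiff.2 he, path_succ_of_exists he, cond_true]
      · rw [Bool.eq_false_iff.2 fun h => he (hiff.1 h), path_succ_of_not_exists he, cond_false]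
    by_cases he : ∃ y, t ≤ y ∧ fits c (path c t) y = true
    · obtain ⟨y, hty, hy⟩ := he
      refine ⟨max W (y + 1), fun w hw => hstep w (by omega) (by omega) ?_⟩
      rw [search_iff]
      exact ⟨fun _ => ⟨y, hty, hy⟩,
        fun _ => ⟨y, by omega, hty, by rw [hfits w y (by omega) (by omega)]; exact hy⟩⟩
    · refine ⟨max W (t + 1), fun w hw => hstep w (by omega) (by omega) ?_⟩
      rw [search_iff]
      constructor
      · rintro ⟨y, hyw, hty, hy⟩
        exact ⟨y, hty, by rwa [hfits w y (by omega) hyw] at hy⟩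
      · exact fun h => (he h).elim

/-- The values of `c` below `n`. -/
def table (c : ℕ → Bool) (n : ℕ) : List Bool :=
  Nat.rec [] (fun k l => l ++ [c k]) n

lemma table_eq_map (c : ℕ → Bool) (n : ℕ) : table c n = (List.range n).map c := by
  induction n with
  | zero => rfl
  | succ n ih =>
    rw [List.range_succ, List.map_append, ← ih]; rfl

lemma table_getD {c : ℕ → Bool} {n k : ℕ} (h : k < n) : (table c n).getD k false = c k := by
  rw [table_eq_map]
  simp [List.getD, h]

lemma computable_table {c : ℕ → Bool} (hc : Computable c) : Computable (table c) :=
  Computable.nat_rec Computable.id (Computable.const [])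
    (Computable.list_concat.comp (Computable.snd.comp Computable.snd)
      (hc.comp (Computable.fst.comp Computable.snd))).to₂

/-- `x` occurs on the path, either with color `true` or with a color for which `k` holds. -/
def occurs (k : Bool) (L : Path) (x : ℕ) : Bool :=
  L.foldr (fun p r => (p.1 == x && (p.2 || k)) || r) false

lemma occurs_iff (k : Bool) (L : Path) (x : ℕ) :
    occurs k L x = true ↔ ∃ i, (x, i) ∈ L ∧ (i = true ∨ k = true) := by
  induction L with
  | nil => simp [occurs]
  | cons p L ih =>
    change ((p.1 == x && (p.2 || k)) || occurs k L x) = true ↔ _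
    obtain ⟨a, j⟩ := p
    rw [Bool.or_eq_true, ih]
    simp only [List.mem_cons, Prod.mk.injEq, Bool.and_eq_true, Bool.or_eq_true, beq_iff_eq]
    constructor
    · rintro (⟨rfl, h⟩ | ⟨i, h, h'⟩)
      · exact ⟨j, Or.inl ⟨rfl, rfl⟩, h⟩
      · exact ⟨i, Or.inr h, h'⟩
    · rintro ⟨i, ⟨rfl, rfl⟩ | h, h'⟩
      · exact Or.inl ⟨rfl, h'⟩
      · exact Or.inr ⟨i, h, h'⟩

section Primrec

variable {α : Type*} [Primcodable α]

lemma primrec_fits {T : α → List Bool} {L : α → Path} {y : α → ℕ}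
    (hT : Primrec T) (hL : Primrec L) (hy : Primrec y) :
    Primrec fun a => fits (fun n => (T a).getD n false) (L a) (y a) := by
  refine Primrec.list_foldr (h := fun a (q : (ℕ × Bool) × Bool) =>
    ((T a).getD (y a + q.1.1) false == q.1.2) && q.2) hL (Primrec.const true) ?_
  have hp : Primrec fun q : α × (ℕ × Bool) × Bool => q.2.1 := Primrec.fst.comp Primrec.snd
  exact Primrec.and.comp
    (Primrec.beq.comp
      ((Primrec.list_getD false).comp (hT.comp Primrec.fst)
        (Primrec.nat_add.comp (hy.comp Primrec.fst) (Primrec.fst.comp hp)))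
      (Primrec.snd.comp hp))
    (Primrec.snd.comp Primrec.snd)

lemma primrec_backtrack : Primrec backtrack := by
  refine Primrec.list_rec (h := fun _ (q : (ℕ × Bool) × Path × Path) =>
    bif q.1.2 then (q.1.1, false) :: q.2.1 else q.2.2) Primrec.id (Primrec.const []) ?_
  have hp : Primrec fun q : Path × (ℕ × Bool) × Path × Path => q.2.1 :=
    Primrec.fst.comp Primrec.snd
  have hr : Primrec fun q : Path × (ℕ × Bool) × Path × Path => q.2.2 :=
    Primrec.snd.comp Primrec.snd
  exact Primrec.cond (Primrec.snd.comp hp)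
    (Primrec.list_cons.comp (Primrec.pair (Primrec.fst.comp hp) (Primrec.const false))
      (Primrec.fst.comp hr))
    (Primrec.snd.comp hr)

lemma primrec_search {T : α → List Bool} {w t : α → ℕ} {L : α → Path}
    (hT : Primrec T) (hw : Primrec w) (ht : Primrec t) (hL : Primrec L) :
    Primrec fun a => search (fun n => (T a).getD n false) (w a) (t a) (L a) := by
  refine Primrec.list_foldr (h := fun a (q : ℕ × Bool) =>
    (decide (t a ≤ q.1) && fits (fun n => (T a).getD n false) (L a) q.1) || q.2)
    (Primrec.list_range.comp hw) (Primrec.const false) ?_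
  have hy : Primrec fun q : α × ℕ × Bool => q.2.1 := Primrec.fst.comp Primrec.snd
  exact Primrec.or.comp
    (Primrec.and.comp
      (Primrec.nat_le.decide.comp (ht.comp Primrec.fst) hy)
      (primrec_fits (hT.comp Primrec.fst) (hL.comp Primrec.fst) hy))
    (Primrec.snd.comp Primrec.snd)

lemma primrec_approx {T : α → List Bool} {w t : α → ℕ}
    (hT : Primrec T) (hw : Primrec w) (ht : Primrec t) :
    Primrec fun a => approx (fun n => (T a).getD n false) (w a) (t a) := by
  refine Primrec.nat_rec' (h := fun a (q : ℕ × Path) =>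
    step (fun n => (T a).getD n false)
      (search (fun n => (T a).getD n false) (w a) q.1 q.2) q.1 q.2) ht (Primrec.const []) ?_
  have hs : Primrec fun q : α × ℕ × Path => q.2.1 := Primrec.fst.comp Primrec.snd
  have hL : Primrec fun q : α × ℕ × Path => q.2.2 := Primrec.snd.comp Primrec.snd
  exact Primrec.cond (primrec_search (hT.comp Primrec.fst) (hw.comp Primrec.fst) hs hL)
    (Primrec.cond (primrec_fits (hT.comp Primrec.fst) hL hs)
      (Primrec.list_cons.comp (Primrec.pair hs (Primrec.const true)) hL) hL)
    (primrec_backtrack.comp hL)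

lemma primrec_occurs (k : Bool) {L : α → Path} {x : α → ℕ} (hL : Primrec L) (hx : Primrec x) :
    Primrec fun a => occurs k (L a) (x a) := by
  refine Primrec.list_foldr (h := fun a (q : (ℕ × Bool) × Bool) =>
    (q.1.1 == x a && (q.1.2 || k)) || q.2) hL (Primrec.const false) ?_
  have hp : Primrec fun q : α × (ℕ × Bool) × Bool => q.2.1 := Primrec.fst.comp Primrec.snd
  exact Primrec.or.comp
    (Primrec.and.comp
      (Primrec.beq.comp (Primrec.fst.comp hp) (hx.comp Primrec.fst))
      (Primrec.or.comp (Primrec.snd.comp hp) (Primrec.const k)))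
    (Primrec.snd.comp Primrec.snd)

end Primrec

/-- The matrix of the `Π⁰₂` definition: `a` codes a time `t` and a bound `w`, and `b ≥ w` is a
search bound for which `x` occurs on the approximation at time `t`. -/
def matrix (c : ℕ → Bool) (k : Bool) (N x a b : ℕ) : Bool :=
  decide (N ≤ x) && (decide (a.unpair.1 ≤ x) || (decide (a.unpair.2 ≤ b) &&
    occurs k (approx (fun n => (table c (2 * b)).getD n false) b a.unpair.1) x))

lemma computable_matrix {c : ℕ → Bool} (hc : Computable c) (k : Bool) (N : ℕ) :
    Computable fun p : ℕ × ℕ × ℕ => matrix c k N p.1 p.2.1 p.2.2 := by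
  have hx : Primrec fun q : (ℕ × ℕ × ℕ) × List Bool => q.1.1 := Primrec.fst.comp Primrec.fst
  have ha : Primrec fun q : (ℕ × ℕ × ℕ) × List Bool => q.1.2.1.unpair :=
    Primrec.unpair.comp (Primrec.fst.comp (Primrec.snd.comp Primrec.fst))
  have hb : Primrec fun q : (ℕ × ℕ × ℕ) × List Bool => q.1.2.2 :=
    Primrec.snd.comp (Primrec.snd.comp Primrec.fst)
  have hocc := primrec_occurs k (primrec_approx Primrec.snd hb (Primrec.fst.comp ha)) hx
  have hmain := Primrec.and.comp (Primrec.nat_le.decide.comp (Primrec.const N) hx)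
    (Primrec.or.comp (Primrec.nat_le.decide.comp (Primrec.fst.comp ha) hx)
      (Primrec.and.comp (Primrec.nat_le.decide.comp (Primrec.snd.comp ha) hb) hocc))
  have htable : Computable fun p : ℕ × ℕ × ℕ => table c (2 * p.2.2) :=
    (computable_table hc).comp
      (Primrec.nat_mul.comp (Primrec.const 2) (Primrec.snd.comp Primrec.snd)).to_comp
  exact (hmain.to_comp.comp (Computable.pair Computable.id htable)).of_eq fun _ => rfl

lemma forall_exists_matrix_iff (c : ℕ → Bool) (k : Bool) (N x : ℕ) :
    (∀ a, ∃ b, matrix c k N x a b = true) ↔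
      N ≤ x ∧ ∀ t, x < t → ∃ i, (x, i) ∈ path c t ∧ (i = true ∨ k = true) := by
  have hlim := eventually_approx_eq (c := c) (d := fun w n => (table c (2 * w)).getD n false)
    fun w n h => table_getD h
  simp only [matrix, Bool.and_eq_true, Bool.or_eq_true, decide_eq_true_eq]
  constructor
  · intro h
    refine ⟨(h 0).choose_spec.1, fun t ht => ?_⟩
    obtain ⟨W, hW⟩ := hlim t
    obtain ⟨b, -, hb⟩ := h (Nat.pair t W)
    rw [Nat.unpair_pair] at hb
    rcases hb with hb | ⟨hb, hocc⟩
    · exact absurd hb (not_le.2 ht)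
    · rwa [hW b hb, occurs_iff] at hocc
  · rintro ⟨hN, h⟩ a
    by_cases hax : a.unpair.1 ≤ x
    · exact ⟨0, hN, Or.inl hax⟩
    · obtain ⟨W, hW⟩ := hlim a.unpair.1
      refine ⟨max W a.unpair.2, hN, Or.inr ⟨le_max_right _ _, ?_⟩⟩
      rw [hW _ (le_max_left _ _), occurs_iff]
      exact h _ (not_le.1 hax)

end HindmanSums

open HindmanSums in
/-- Every computable instance of `HT^{=2}_2` has a `Π⁰₂` solution: for every computable
coloring `c : ℕ → Bool` there is a computable relation `R` such that the set
`{n | ∀ a, ∃ b, R n a b}` is infinite and homogeneous for sums of two distinct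
elements under `c`. -/
theorem stmt_11 (c : ℕ → Bool) (hc : Computable c) :
    ∃ R : ℕ → ℕ → ℕ → Bool,
      Computable (fun p : ℕ × ℕ × ℕ => R p.1 p.2.1 p.2.2) ∧
      {n : ℕ | ∀ a : ℕ, ∃ b : ℕ, R n a b = true}.Infinite ∧
      ∃ i : Bool, ∀ x ∈ {n : ℕ | ∀ a : ℕ, ∃ b : ℕ, R n a b = true},
        ∀ y ∈ {n : ℕ | ∀ a : ℕ, ∃ b : ℕ, R n a b = true},
          x ≠ y → c (x + y) = i := by
  by_cases hred : (trueSurvivors c).Infinite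
  · have hset : {n | ∀ a, ∃ b, matrix c false 0 n a b = true} = trueSurvivors c := by
      ext x
      rw [Set.mem_ofPred_eq, forall_exists_matrix_iff]
      simp [trueSurvivors]
    refine ⟨matrix c false 0, computable_matrix hc _ _, ?_⟩
    rw [hset]
    exact ⟨hred, true, color_add_of_mem_trueSurvivors⟩
  · rw [Set.not_infinite] at hred
    obtain ⟨N, hN⟩ := hred.bddAbove
    have hset : {n | ∀ a, ∃ b, matrix c true (N + 1) n a b = true} =
        survivors c \ Set.Iic N := by
      ext x
      rw [Set.mem_ofPred_eq, forall_exists_matrix_iff]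
      simp [survivors, and_comm]
    have hsub : survivors c \ Set.Iic N ⊆ survivors c \ trueSurvivors c :=
      Set.sdiff_subset_sdiff_right fun x hx => hN hx
    refine ⟨matrix c true (N + 1), computable_matrix hc _ _, ?_⟩
    rw [hset]
    exact ⟨(infinite_survivors c).sdiff (Set.finite_Iic N), false, fun x hx y hy =>
      color_add_of_mem_survivors_diff x (hsub hx) y (hsub hy)⟩
end
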